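/- arXiv:1301.3374 — 3 statements merged into one kernel-verified Lean document; each statement's English description precedes it below -/
import Mathlib

section
/- Let X be a real Banach space that is isomorphic (linearly homeomorphic) to an infinite-dimensional closed subspace of ℓ∞ (the space of bounded real sequences with the supremum norm). If X is universally left-stable, then X is isomorphic to ℓ∞. -/
open scoped ENNReal ZeroAtInfty

noncomputable section

/-- `f : X → Y` is a *standard ε-isometry*: `f 0 = 0` and
`|‖f x - f y‖ - ‖x - y‖| ≤ ε` for all `x, y`. -/
def StdEpsIsom {X Y : Type*} [NormedAddCommGroup X] [NormedAddCommGroup Y]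
    (ε : ℝ) (f : X → Y) : Prop :=
  f 0 = 0 ∧ ∀ x y : X, |‖f x - f y‖ - ‖x - y‖| ≤ ε

/-- `L(f)`: the closed linear span of the range of `f` in `Y`. -/
def Lf {X Y : Type*} [NormedAddCommGroup Y] [NormedSpace ℝ Y] (f : X → Y) :
    Submodule ℝ Y :=
  (Submodule.span ℝ (Set.range f)).topologicalClosure

theorem mem_Lf {X Y : Type*} [NormedAddCommGroup Y] [NormedSpace ℝ Y] (f : X → Y) (x : X) :
    f x ∈ Lf f :=
  Submodule.le_topologicalClosure _ (Submodule.subset_span ⟨x, rfl⟩)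

/-- A standard ε-isometry `f` is *stable* if for some `α, γ > 0` there is a bounded linear
operator `T : L(f) → X` with `‖T‖ ≤ α` such that `‖T (f x) - x‖ ≤ γ ε` for all `x`. -/
def IsStable {X Y : Type*} [NormedAddCommGroup X] [NormedSpace ℝ X]
    [NormedAddCommGroup Y] [NormedSpace ℝ Y] (ε : ℝ) (f : X → Y) : Prop :=
  ∃ α γ : ℝ, 0 < α ∧ 0 < γ ∧
    ∃ T : Lf f →L[ℝ] X, ‖T‖ ≤ α ∧ ∀ x : X, ‖T ⟨f x, mem_Lf f x⟩ - x‖ ≤ γ * ε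

/-- The pair `(X, Y)` is *stable* if every standard ε-isometry `f : X → Y` (ε > 0) is stable. -/
def PairStable (X Y : Type*) [NormedAddCommGroup X] [NormedSpace ℝ X]
    [NormedAddCommGroup Y] [NormedSpace ℝ Y] : Prop :=
  ∀ ε : ℝ, 0 < ε → ∀ f : X → Y, StdEpsIsom ε f → IsStable ε f

/-- `ℓ∞`: the Banach space of bounded real sequences with the sup norm. -/
abbrev ellInfty : Type := lp (fun _ : ℕ => ℝ) ∞

/-! ### Operators into sup-normed sequence spaces -/

/-- The space of bounded families. -/
abbrev LI (ι : Type) (F : Type) [NormedAddCommGroup F] : Type := lp (fun _ : ι => F) ∞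

/-- Coordinate evaluation. -/
def ev {ι F : Type} [NormedAddCommGroup F] [NormedSpace ℝ F] (k : ι) : LI ι F →L[ℝ] F :=
  lp.evalCLM ℝ (fun _ : ι => F) ∞ k

@[simp] theorem ev_apply {ι F : Type} [NormedAddCommGroup F] [NormedSpace ℝ F] (k : ι)
    (a : LI ι F) : ev k a = a k := rfl

theorem norm_coord_le {ι F : Type} [NormedAddCommGroup F] (k : ι)
    (a : LI ι F) : ‖a k‖ ≤ ‖a‖ := lp.norm_apply_le_norm (by simp) a k

theorem norm_ev_le {ι F : Type} [NormedAddCommGroup F] [NormedSpace ℝ F] (k : ι) :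
    ‖(ev k : LI ι F →L[ℝ] F)‖ ≤ 1 :=
  ContinuousLinearMap.opNorm_le_bound _ zero_le_one fun a => by
    simpa using norm_coord_le k a

/-- Operator with prescribed uniformly bounded coordinates. -/
def mkOp {ι B F : Type} [NormedAddCommGroup B] [NormedSpace ℝ B] [NormedAddCommGroup F]
    [NormedSpace ℝ F] (g : ι → B →L[ℝ] F) (C : ℝ) (hC : ∀ k, ‖g k‖ ≤ C) : B →L[ℝ] LI ι F :=
  LinearMap.mkContinuous
    { toFun := fun b => ⟨fun k => g k b, memℓp_infty ⟨C * ‖b‖, by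
        rintro _ ⟨k, rfl⟩
        exact (g k).le_of_opNorm_le (hC k) b⟩⟩
      map_add' := fun a b => by ext k; simp; rfl
      map_smul' := fun c b => by ext k; simp } (max C 0) (fun b => by
        refine lp.norm_le_of_forall_le (by positivity) fun k => ?_
        exact (g k).le_of_opNorm_le ((hC k).trans (le_max_left _ _)) b)

@[simp] theorem mkOp_apply {ι B F : Type} [NormedAddCommGroup B] [NormedSpace ℝ B]
    [NormedAddCommGroup F] [NormedSpace ℝ F] (g : ι → B →L[ℝ] F) (C : ℝ) (hC : ∀ k, ‖g k‖ ≤ C)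
    (b : B) (k : ι) : mkOp g C hC b k = g k b := rfl

theorem norm_mkOp_le {ι B F : Type} [NormedAddCommGroup B] [NormedSpace ℝ B]
    [NormedAddCommGroup F] [NormedSpace ℝ F] (g : ι → B →L[ℝ] F) (C : ℝ) (hC : ∀ k, ‖g k‖ ≤ C)
    (h0 : 0 ≤ C) : ‖mkOp g C hC‖ ≤ C :=
  ContinuousLinearMap.opNorm_le_bound _ h0 fun b =>
    lp.norm_le_of_forall_le (by positivity) fun k => (g k).le_of_opNorm_le (hC k) b

/-! ### Hahn-Banach -/

theorem hb_functional {A B : Type} [NormedAddCommGroup A] [NormedSpace ℝ A]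
    [NormedAddCommGroup B] [NormedSpace ℝ B] (U : A →L[ℝ] B) (K : ℝ)
    (hU : ∀ a, ‖a‖ ≤ K * ‖U a‖) (ψ : A →L[ℝ] ℝ) :
    ∃ g : B →L[ℝ] ℝ, (∀ a, g (U a) = ψ a) ∧ ‖g‖ ≤ max (‖ψ‖ * K) 0 := by
  have hinj : Function.Injective (U : A →ₗ[ℝ] B) := by
    rw [← LinearMap.ker_eq_bot, LinearMap.ker_eq_bot']
    intro a ha
    have := hU a
    have h0 : U a = 0 := ha
    rw [h0] at this
    simpa using this
  let E := LinearEquiv.ofInjective (U : A →ₗ[ℝ] B) hinj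
  have hE : ∀ z, U (E.symm z) = z := fun z => by
    have : E (E.symm z) = z := E.apply_symm_apply z
    exact congrArg Subtype.val this
  have hbd : ∀ z, ‖(ψ : A →ₗ[ℝ] ℝ) (E.symm z)‖ ≤ max (‖ψ‖ * K) 0 * ‖z‖ := fun z => by
    have h1 := hU (E.symm z)
    rw [hE] at h1
    calc ‖ψ (E.symm z)‖ ≤ ‖ψ‖ * ‖E.symm z‖ := ψ.le_opNorm _
      _ ≤ ‖ψ‖ * (K * ‖(z : B)‖) := by gcongr
      _ = (‖ψ‖ * K) * ‖z‖ := by rw [Submodule.coe_norm]; ring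
      _ ≤ _ := by gcongr; exact le_max_left _ _
  let f : (LinearMap.range (U : A →ₗ[ℝ] B)) →L[ℝ] ℝ :=
    LinearMap.mkContinuous ((ψ : A →ₗ[ℝ] ℝ) ∘ₗ E.symm.toLinearMap) _ hbd
  obtain ⟨g, hg, hn⟩ := exists_extension_norm_eq (𝕜 := ℝ) _ f
  refine ⟨g, fun a => ?_, ?_⟩
  · have := hg (E a)
    have h2 : ((E a : LinearMap.range (U : A →ₗ[ℝ] B)) : B) = U a := rfl
    rw [h2] at this
    rw [this]
    change ψ (E.symm (E a)) = ψ a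
    rw [E.symm_apply_apply]
  · rw [hn]
    exact LinearMap.mkContinuous_norm_le _ (le_max_right _ _) _

theorem hb_extend {A B ι : Type} [NormedAddCommGroup A] [NormedSpace ℝ A]
    [NormedAddCommGroup B] [NormedSpace ℝ B] (U : A →L[ℝ] B) (K : ℝ)
    (hU : ∀ a, ‖a‖ ≤ K * ‖U a‖) (S : A →L[ℝ] LI ι ℝ) :
    ∃ R : B →L[ℝ] LI ι ℝ, ∀ a, R (U a) = S a := by
  choose g hg hn using fun k : ι => hb_functional U K hU ((ev k).comp S)
  have hb : ∀ k, ‖g k‖ ≤ ‖S‖ * |K| := fun k => by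
    refine (hn k).trans (max_le ?_ (by positivity))
    have : ‖(ev k).comp S‖ ≤ ‖S‖ := by
      refine (ContinuousLinearMap.opNorm_comp_le _ _).trans ?_
      have := norm_ev_le (F := ℝ) k
      nlinarith [norm_nonneg S]
    calc ‖(ev k).comp S‖ * K ≤ ‖(ev k).comp S‖ * |K| := by gcongr; exact le_abs_self K
      _ ≤ _ := by gcongr
  refine ⟨mkOp g _ hb, fun a => ?_⟩
  ext k
  simp [hg]

/-! ### Decomposition method -/

theorem exists_curryIso : Nonempty (LI ℕ ℝ ≃L[ℝ] LI ℕ (LI ℕ ℝ)) := by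
  let f : LI ℕ ℝ →L[ℝ] LI ℕ (LI ℕ ℝ) :=
    mkOp (fun n => mkOp (fun m => ev (Nat.pair n m)) 1 (fun m => norm_ev_le _)) 1
      (fun n => norm_mkOp_le _ _ _ zero_le_one)
  let g : LI ℕ (LI ℕ ℝ) →L[ℝ] LI ℕ ℝ :=
    mkOp (fun k => (ev (Nat.unpair k).2).comp (ev (Nat.unpair k).1)) 1 (fun k => by
      refine (ContinuousLinearMap.opNorm_comp_le _ _).trans ?_
      exact mul_le_one₀ (norm_ev_le _) (norm_nonneg _) (norm_ev_le _))
  have h1 : ∀ a n m, f a n m = a (Nat.pair n m) := fun a n m => rfl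
  have h2 : ∀ a k, g a k = a (Nat.unpair k).1 (Nat.unpair k).2 := fun a k => rfl
  clear_value f g
  refine ⟨ContinuousLinearEquiv.equivOfInverse f g (fun a => ?_) (fun a => ?_)⟩
  · apply lp.ext
    funext k
    rw [h2, h1, Nat.pair_unpair]
  · apply lp.ext
    funext n
    apply lp.ext
    funext m
    rw [h1, h2, Nat.unpair_pair]

/-- Coordinates of the inverse of `sumIso`. -/
def sumCoord (s : ℕ ⊕ ℕ) : (LI ℕ ℝ × LI ℕ ℝ) →L[ℝ] ℝ :=
  Sum.elim (fun n => (ev n).comp (ContinuousLinearMap.fst ℝ _ _))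
      (fun n => (ev n).comp (ContinuousLinearMap.snd ℝ _ _)) s

@[simp] theorem sumCoord_inl (n : ℕ) (a) : sumCoord (Sum.inl n) a = a.1 n := rfl

@[simp] theorem sumCoord_inr (n : ℕ) (a) : sumCoord (Sum.inr n) a = a.2 n := rfl

theorem norm_sumCoord_le (s : ℕ ⊕ ℕ) : ‖sumCoord s‖ ≤ 1 := by
  refine ContinuousLinearMap.opNorm_le_bound _ zero_le_one fun a => ?_
  rcases s with n | n
  · rw [sumCoord_inl, one_mul]
    exact (norm_coord_le n a.1).trans (norm_fst_le a)
  · rw [sumCoord_inr, one_mul]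
    exact (norm_coord_le n a.2).trans (norm_snd_le a)

theorem exists_sumIso (E : ℕ ⊕ ℕ ≃ ℕ) : Nonempty (LI ℕ ℝ ≃L[ℝ] LI ℕ ℝ × LI ℕ ℝ) := by
  let f1 : LI ℕ ℝ →L[ℝ] LI ℕ ℝ := mkOp (fun n => ev (E (Sum.inl n))) 1 (fun m => norm_ev_le _)
  let f2 : LI ℕ ℝ →L[ℝ] LI ℕ ℝ := mkOp (fun n => ev (E (Sum.inr n))) 1 (fun m => norm_ev_le _)
  let g : LI ℕ ℝ × LI ℕ ℝ →L[ℝ] LI ℕ ℝ :=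
    mkOp (fun k => sumCoord (E.symm k)) 1 (fun k => norm_sumCoord_le _)
  have h1 : ∀ a n, f1 a n = a (E (Sum.inl n)) := fun a n => rfl
  have h2 : ∀ a n, f2 a n = a (E (Sum.inr n)) := fun a n => rfl
  have h3 : ∀ a k, g a k = sumCoord (E.symm k) a := fun a n => rfl
  have hl : ∀ a, g (f1 a, f2 a) = a := by
    intro a
    apply lp.ext
    funext k
    rw [h3]
    obtain ⟨s, rfl⟩ := E.surjective k
    rw [E.symm_apply_apply]
    rcases s with n | n
    · rw [sumCoord_inl, h1]
    · rw [sumCoord_inr, h2]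
  have hr1 : ∀ a, f1 (g a) = a.1 := by
    intro a
    apply lp.ext
    funext k
    rw [h1, h3, E.symm_apply_apply, sumCoord_inl]
  have hr2 : ∀ a, f2 (g a) = a.2 := by
    intro a
    apply lp.ext
    funext k
    rw [h2, h3, E.symm_apply_apply, sumCoord_inr]
  clear_value f1 f2 g
  exact ⟨ContinuousLinearEquiv.equivOfInverse (f1.prod f2) g hl
    (fun a => Prod.ext (hr1 a) (hr2 a))⟩

theorem swindle {X L : Type} [NormedAddCommGroup X] [NormedSpace ℝ X]
    [NormedAddCommGroup L] [NormedSpace ℝ L] (i : X →L[ℝ] L) (P : L →L[ℝ] X)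
    (hP : ∀ x, P (i x) = x) : Nonempty ((X × LI ℕ L) ≃L[ℝ] LI ℕ L) := by
  let Q : L →L[ℝ] L := i.comp P
  let Q' : L →L[ℝ] L := ContinuousLinearMap.id ℝ L - Q
  have hev : ∀ (T : L →L[ℝ] L) (n : ℕ), ‖T.comp (ev n)‖ ≤ ‖T‖ := fun T n => by
    refine (ContinuousLinearMap.opNorm_comp_le _ _).trans ?_
    have := norm_ev_le (F := L) n
    nlinarith [norm_nonneg T]
  have hsnd : ∀ (T : LI ℕ L →L[ℝ] L),
      ‖T.comp (ContinuousLinearMap.snd ℝ X (LI ℕ L))‖ ≤ ‖T‖ := fun T => by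
    refine (ContinuousLinearMap.opNorm_comp_le _ _).trans ?_
    have := ContinuousLinearMap.norm_snd_le ℝ X (LI ℕ L)
    nlinarith [norm_nonneg T]
  let c : ℕ → (X × LI ℕ L) →L[ℝ] L := fun n => Nat.casesOn n
    (i.comp (ContinuousLinearMap.fst ℝ _ _))
    (fun m => (Q.comp (ev m)).comp (ContinuousLinearMap.snd ℝ _ _))
  have hc : ∀ n, ‖c n‖ ≤ ‖i‖ + ‖Q‖ := fun n => by
    cases n with
    | zero =>
      refine (ContinuousLinearMap.opNorm_comp_le _ _).trans ?_
      have := ContinuousLinearMap.norm_fst_le ℝ X (LI ℕ L)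
      nlinarith [norm_nonneg i, norm_nonneg Q]
    | succ m =>
      have := (hsnd (Q.comp (ev m))).trans (hev Q m)
      have h2 := norm_nonneg i
      change ‖(Q.comp (ev m)).comp (ContinuousLinearMap.snd ℝ X (LI ℕ L))‖ ≤ _
      linarith
  let f : ℕ → (X × LI ℕ L) →L[ℝ] L := fun n =>
    c n + (Q'.comp (ev n)).comp (ContinuousLinearMap.snd ℝ _ _)
  have hf : ∀ n, ‖f n‖ ≤ ‖i‖ + ‖Q‖ + ‖Q'‖ := fun n =>
    (norm_add_le _ _).trans (add_le_add (hc n) ((hsnd _).trans (hev _ _)))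
  let g : ℕ → LI ℕ L →L[ℝ] L := fun n => Q'.comp (ev n) + Q.comp (ev (n + 1))
  have hg : ∀ n, ‖g n‖ ≤ ‖Q'‖ + ‖Q‖ := fun n =>
    (norm_add_le _ _).trans (add_le_add (hev _ _) (hev _ _))
  refine ⟨ContinuousLinearEquiv.equivOfInverse (mkOp f _ hf)
    ((P.comp (ev 0)).prod (mkOp g _ hg)) ?_ ?_⟩
  · rintro ⟨x, a⟩
    refine Prod.ext ?_ ?_
    · simp [f, c, Q', Q, hP]
    · ext n
      cases n <;> simp [f, c, g, Q', Q, hP]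
  · intro b
    ext n
    cases n <;> simp [f, c, g, Q', Q, hP]

theorem decomposition {X : Type} [NormedAddCommGroup X] [NormedSpace ℝ X]
    (i : X →L[ℝ] LI ℕ ℝ) (P : LI ℕ ℝ →L[ℝ] X) (hP : ∀ x, P (i x) = x)
    (U : LI ℕ ℝ →L[ℝ] X) (R : X →L[ℝ] LI ℕ ℝ) (hR : ∀ x, R (U x) = x) :
    Nonempty (X ≃L[ℝ] LI ℕ ℝ) := by
  obtain ⟨s⟩ := swindle i P hP
  obtain ⟨curryIso⟩ := exists_curryIso
  obtain ⟨sumIso⟩ := exists_sumIso Equiv.natSumNatEquivNat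
  let E1 : X ≃L[ℝ] LI ℕ ℝ × R.ker := ContinuousLinearEquiv.equivOfRightInverse R U hR
  let E2 : X ≃L[ℝ] LI ℕ ℝ × X :=
    E1.trans (((sumIso.prodCongr (ContinuousLinearEquiv.refl ℝ _)).trans
      (ContinuousLinearEquiv.prodAssoc ℝ _ _ _)).trans
      ((ContinuousLinearEquiv.refl ℝ _).prodCongr E1.symm))
  let E3 : X ≃L[ℝ] X × LI ℕ ℝ := E2.trans (ContinuousLinearEquiv.prodComm ℝ _ _)
  exact ⟨E3.trans ((((ContinuousLinearEquiv.refl ℝ X).prodCongr curryIso).trans s).trans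
    curryIso.symm)⟩

/-! ### Finitely additive set functions -/

/-- Finitely additive nonnegative set functions. -/
def FA (ν : Set ℕ → ℝ) : Prop :=
  (∀ A, 0 ≤ ν A) ∧ ∀ A B, Disjoint A B → ν (A ∪ B) = ν A + ν B

theorem FA.mono {ν : Set ℕ → ℝ} (h : FA ν) {A B : Set ℕ} (hAB : A ⊆ B) : ν A ≤ ν B := by
  have := h.2 A (B \ A) Set.disjoint_sdiff_right
  rw [Set.union_sdiff_cancel hAB] at this
  linarith [h.1 (B \ A)]

theorem FA.empty {ν : Set ℕ → ℝ} (h : FA ν) : ν ∅ = 0 := by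
  have := h.2 ∅ ∅ (by simp)
  simp at this
  exact this

theorem FA.inter_add_diff {ν : Set ℕ → ℝ} (h : FA ν) (A B : Set ℕ) :
    ν A = ν (A ∩ B) + ν (A \ B) := by
  have := h.2 (A ∩ B) (A \ B) (Set.disjoint_left.2 fun x hx hy => hy.2 hx.2)
  rwa [Set.inter_union_sdiff] at this

theorem FA.biUnion_eq {ν : Set ℕ → ℝ} (h : FA ν) {ι : Type} (s : Finset ι) (B : ι → Set ℕ)
    (hd : ∀ i ∈ s, ∀ j ∈ s, i ≠ j → Disjoint (B i) (B j)) :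
    ν (⋃ j ∈ s, B j) = ∑ j ∈ s, ν (B j) := by
  classical
  induction s using Finset.induction_on with
  | empty => simp [h.empty]
  | insert a s ha ih =>
    rw [Finset.sum_insert ha, Finset.set_biUnion_insert, h.2, ih]
    · intro i hi j hj
      exact hd i (Finset.mem_insert_of_mem hi) j (Finset.mem_insert_of_mem hj)
    · rw [Set.disjoint_iUnion₂_right]
      intro j hj
      exact hd a (Finset.mem_insert_self _ _) j (Finset.mem_insert_of_mem hj)
        (fun e => ha (e ▸ hj))

theorem rosenthal (ν : ℕ → Set ℕ → ℝ) (hν : ∀ n, FA (ν n)) (η : ℝ) (hη : 0 < η) (k : ℕ) :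
    ∀ M : Set ℕ, M.Infinite → (∀ n ∈ M, ν n M ≤ k * η) →
      ∃ M' : Set ℕ, M'.Infinite ∧ ∀ n ∈ M', ν n (M' \ {n}) ≤ η := by
  induction k with
  | zero =>
    intro M hM h
    refine ⟨M, hM, fun n hn => ?_⟩
    have h1 := (hν n).mono (Set.sdiff_subset (s := M) (t := {n}))
    have h2 := h n hn
    simp at h2
    linarith
  | succ k ih =>
    intro M hM h
    let f := hM.natEmbedding
    let N : ℕ → Set ℕ := fun p => Set.range fun m => (f (Nat.pair p m) : ℕ)
    have hNM : ∀ p, N p ⊆ M := by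
      rintro p _ ⟨m, rfl⟩
      exact (f (Nat.pair p m)).2
    have hinj : ∀ a b, (f a : ℕ) = f b → a = b := fun a b hab =>
      f.injective (Subtype.ext hab)
    have hNinf : ∀ p, (N p).Infinite := fun p => by
      apply Set.infinite_range_of_injective
      intro a b hab
      have := hinj _ _ hab
      rw [Nat.pair_eq_pair] at this
      exact this.2
    have hNd : ∀ p q x, x ∈ N p → x ∈ N q → p = q := by
      rintro p q _ ⟨m, rfl⟩ ⟨m', hm'⟩
      have := hinj _ _ hm'
      rw [Nat.pair_eq_pair] at this
      exact this.1.symm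
    by_cases hgood : ∃ p, ∀ n ∈ N p, ν n (N p \ {n}) ≤ η
    · obtain ⟨p, hp⟩ := hgood
      exact ⟨N p, hNinf p, hp⟩
    · push Not at hgood
      choose n hn hnη using hgood
      refine ih (Set.range n) ?_ ?_
      · apply Set.infinite_range_of_injective
        intro p q hpq
        exact hNd p q (n p) (hn p) (hpq ▸ hn q)
      · rintro _ ⟨p, rfl⟩
        have hd : Disjoint (Set.range n) (N p \ {n p}) := by
          rw [Set.disjoint_left]
          rintro _ ⟨q, rfl⟩ ⟨h1, h2⟩
          have := hNd q p (n q) (hn q) h1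
          subst this
          exact h2 rfl
        have h1 := (hν (n p)).2 _ _ hd
        have h2 : ν (n p) (Set.range n ∪ N p \ {n p}) ≤ ν (n p) M := by
          apply (hν _).mono
          apply Set.union_subset
          · rintro _ ⟨q, rfl⟩
            exact hNM q (hn q)
          · exact Set.sdiff_subset.trans (hNM p)
        have h3 := h (n p) (hNM p (hn p))
        have h4 := hnη p
        push_cast at h3
        linarith

/-- No finite set of indices controls the family on subsets of `S` at level `δ`. -/
def Bad (ν : ℕ → Set ℕ → ℝ) (S : Set ℕ) (δ : ℝ) : Prop :=
  ∀ F : Finset ℕ, ∀ τ : ℝ, 0 < τ → ∃ A ⊆ S, (∀ k ∈ F, ν k A < τ) ∧ ∃ k, δ ≤ ν k A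

theorem Bad.finite_disjoint {ν : ℕ → Set ℕ → ℝ} (hν : ∀ n, FA (ν n)) {S : Set ℕ} {δ : ℝ}
    (hB : Bad ν S δ) (N : ℕ) (τ : ℝ) (hτ : 0 < τ) : ∀ F : Finset ℕ,
      ∃ (B : ℕ → Set ℕ) (k : ℕ → ℕ), (∀ j < N, B j ⊆ S) ∧
        (∀ i < N, ∀ j < N, i ≠ j → Disjoint (B i) (B j)) ∧
        (∀ j < N, δ - N * τ ≤ ν (k j) (B j)) ∧ ∀ j < N, ∀ l ∈ F, ν l (B j) < τ := by
  classical
  induction N with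
  | zero => intro F; exact ⟨fun _ => ∅, fun _ => 0, by simp, by simp, by simp, by simp⟩
  | succ N ih =>
    intro F
    obtain ⟨A, hAS, hAF, k0, hk0⟩ := hB F τ hτ
    obtain ⟨B, k, h1, h2, h3, h4⟩ := ih (insert k0 F)
    let D : Set ℕ := ⋃ j ∈ Finset.range N, B j
    have hD : ν k0 D ≤ N * τ := by
      rw [(hν k0).biUnion_eq]
      · calc ∑ j ∈ Finset.range N, ν k0 (B j) ≤ ∑ j ∈ Finset.range N, τ :=
            Finset.sum_le_sum fun j hj =>
              (h4 j (Finset.mem_range.1 hj) k0 (Finset.mem_insert_self _ _)).le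
          _ = N * τ := by simp
      · intro i hi j hj
        exact h2 i (Finset.mem_range.1 hi) j (Finset.mem_range.1 hj)
    have hBD : ∀ j < N, Disjoint (B j) (A \ D) := fun j hj => by
      rw [Set.disjoint_left]
      intro x hx hx'
      exact hx'.2 (Set.mem_biUnion (Finset.mem_coe.2 (Finset.mem_range.2 hj)) hx)
    have hcase : ∀ j, j < N + 1 → j = N ∨ (j < N ∧ j ≠ N) := fun j hj => by omega
    refine ⟨Function.update B N (A \ D), Function.update k N k0, ?_, ?_, ?_, ?_⟩
    · intro j hj
      rcases hcase j hj with rfl | ⟨hj, hne⟩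
      · simpa using Set.sdiff_subset.trans hAS
      · simpa [hne] using h1 j hj
    · intro i hi j hj hij
      rcases hcase j hj with rfl | ⟨hj, hne⟩ <;> rcases hcase i hi with rfl | ⟨hi, hne'⟩
      · exact absurd rfl hij
      · simpa [hne'] using hBD i hi
      · simpa [hne] using (hBD j hj).symm
      · simpa [hne, hne'] using h2 i hi j hj hij
    · intro j hj
      push_cast
      rcases hcase j hj with rfl | ⟨hj, hne⟩
      · simp only [Function.update_self]
        have e1 := (hν k0).inter_add_diff A D
        have e2 := (hν k0).mono (Set.inter_subset_right (s := A) (t := D))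
        linarith
      · simp only [Function.update_of_ne hne]
        have := h3 j hj
        linarith
    · intro j hj l hl
      rcases hcase j hj with rfl | ⟨hj, hne⟩
      · simp only [Function.update_self]
        exact ((hν l).mono Set.sdiff_subset).trans_lt (hAF l hl)
      · simp only [Function.update_of_ne hne]
        exact h4 j hj l (Finset.mem_insert_of_mem hl)

theorem Bad.step {ν : ℕ → Set ℕ → ℝ} (hν : ∀ n, FA (ν n)) {C : ℝ} (hC : ∀ n, ν n Set.univ ≤ C)
    {S : Set ℕ} {δ σ : ℝ} (hσ : 0 < σ) (hB : Bad ν S δ) :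
    ∃ B ⊆ S, (∃ k, δ - σ ≤ ν k B) ∧ Bad ν (S \ B) (δ - σ) := by
  classical
  obtain ⟨N, hN⟩ := exists_nat_gt (C / σ)
  rw [div_lt_iff₀ hσ] at hN
  obtain ⟨B, k, h1, h2, h3, -⟩ := hB.finite_disjoint hν N (σ / (N + 1)) (by positivity) ∅
  have hlev : (N : ℝ) * (σ / (N + 1)) ≤ σ := by
    rw [mul_div_assoc', div_le_iff₀ (by positivity)]
    nlinarith
  by_contra! hcon
  have hnb : ∀ j, ∃ F : Finset ℕ, ∃ τ : ℝ, 0 < τ ∧ (j < N → ∀ A ⊆ S \ B j,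
      (∀ k ∈ F, ν k A < τ) → ∀ k, ν k A < δ - σ) := by
    intro j
    by_cases hj : j < N
    · have := hcon (B j) (h1 j hj) ⟨k j, by linarith [h3 j hj]⟩
      unfold Bad at this
      push Not at this
      obtain ⟨F, τ, hτ, hh⟩ := this
      exact ⟨F, τ, hτ, fun _ => hh⟩
    · exact ⟨∅, 1, one_pos, fun h => absurd h hj⟩
  choose F τ hτ hF using hnb
  obtain ⟨t, ht0, ht⟩ : ∃ t : ℝ, 0 < t ∧ ∀ j < N, t ≤ τ j := by
    clear * - hτ
    induction N with
    | zero => exact ⟨1, one_pos, by simp⟩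
    | succ N ih =>
      obtain ⟨t, ht0, ht⟩ := ih
      refine ⟨min t (τ N), lt_min ht0 (hτ N), fun j hj => ?_⟩
      rcases Nat.lt_succ_iff_lt_or_eq.1 hj with h | rfl
      · exact (min_le_left _ _).trans (ht j h)
      · exact min_le_right _ _
  obtain ⟨A, hAS, hAF, l, hl⟩ := hB ((Finset.range N).biUnion F) t ht0
  have hbig : ∀ j < N, σ ≤ ν l (B j) := by
    intro j hj
    have h5 := hF j hj (A \ B j) (Set.sdiff_subset_sdiff_left hAS) (fun m hm => by
      refine ((hν m).mono Set.sdiff_subset).trans_lt ((hAF m ?_).trans_le (ht j hj))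
      exact Finset.mem_biUnion.2 ⟨j, Finset.mem_range.2 hj, hm⟩) l
    have e1 := (hν l).inter_add_diff A (B j)
    have e2 := (hν l).mono (Set.inter_subset_right (s := A) (t := B j))
    linarith
  have hsum := (hν l).biUnion_eq (Finset.range N) B (fun i hi j hj =>
    h2 i (Finset.mem_range.1 hi) j (Finset.mem_range.1 hj))
  have hle := (hν l).mono (Set.subset_univ (⋃ j ∈ Finset.range N, B j))
  have : (N : ℝ) * σ ≤ ∑ j ∈ Finset.range N, ν l (B j) := by
    calc (N : ℝ) * σ = ∑ j ∈ Finset.range N, σ := by simp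
      _ ≤ _ := Finset.sum_le_sum fun j hj => hbig j (Finset.mem_range.1 hj)
  linarith [hC l]

theorem dichotomy {ν : ℕ → Set ℕ → ℝ} (hν : ∀ n, FA (ν n)) {C : ℝ} (hC : ∀ n, ν n Set.univ ≤ C)
    {δ : ℝ} (hδ : 0 < δ) :
    (∃ F : Finset ℕ, ∃ τ : ℝ, 0 < τ ∧ ∀ A, (∀ k ∈ F, ν k A < τ) → ∀ k, ν k A < δ) ∨
    ∃ (B : ℕ → Set ℕ) (k : ℕ → ℕ), (∀ i j, i ≠ j → Disjoint (B i) (B j)) ∧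
      ∀ n, δ / 2 ≤ ν (k n) (B n) := by
  by_cases hB : Bad ν Set.univ δ
  swap
  · left
    unfold Bad at hB
    push Not at hB
    obtain ⟨F, τ, hτ, h⟩ := hB
    exact ⟨F, τ, hτ, fun A => h A (Set.subset_univ _)⟩
  right
  let St := {p : Set ℕ × ℝ // Bad ν p.1 p.2 ∧ δ / 2 < p.2}
  have hstep : ∀ p : St, ∃ q : St, ∃ B : Set ℕ, ∃ k : ℕ, B ⊆ p.1.1 ∧ δ / 2 ≤ ν k B ∧
      q.1.1 = p.1.1 \ B := by
    rintro ⟨⟨S, d⟩, hb, hd⟩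
    simp only at hb hd
    obtain ⟨B, hBS, ⟨k, hk⟩, hbad⟩ := hb.step hν hC (σ := (d - δ / 2) / 2) (by linarith)
    exact ⟨⟨⟨S \ B, _⟩, hbad, by simp only; linarith⟩, B, k, hBS, by linarith, rfl⟩
  choose nx B k hBS hk hnx using hstep
  let p : ℕ → St := fun n => nx^[n] ⟨⟨Set.univ, δ⟩, hB, by simp only; linarith⟩
  have hp : ∀ n, p (n + 1) = nx (p n) := fun n => Function.iterate_succ_apply' _ _ _
  have hanti : ∀ n m, n ≤ m → (p m).1.1 ⊆ (p n).1.1 := by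
    intro n m hnm
    induction m, hnm using Nat.le_induction with
    | base => exact subset_rfl
    | succ m _ ih =>
      rw [hp, hnx]
      exact Set.sdiff_subset.trans ih
  have hlt : ∀ i j, i < j → Disjoint (B (p i)) (B (p j)) := by
    intro i j hij
    rw [Set.disjoint_left]
    intro x hx hx'
    have h1 := hanti (i + 1) j hij (hBS _ hx')
    rw [hp, hnx] at h1
    exact h1.2 hx
  refine ⟨fun n => B (p n), fun n => k (p n), fun i j hij => ?_, fun n => hk _⟩
  rcases lt_or_gt_of_ne hij with h | h
  · exact hlt i j h
  · exact (hlt j i h).symm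

/-! ### Variation of a functional -/

/-- Restriction to a set of coordinates. -/
theorem exists_res (A : Set ℕ) : ∃ r : LI ℕ ℝ →L[ℝ] LI ℕ ℝ,
    (∀ a, ∀ t ∈ A, r a t = a t) ∧ ∀ a, ∀ t ∉ A, r a t = 0 := by
  classical
  refine ⟨mkOp (fun t => if t ∈ A then ev t else 0) 1 (fun t => ?_), fun a t ht => ?_,
    fun a t ht => ?_⟩
  · split_ifs
    · exact norm_ev_le _
    · simp
  · simp [ht]
  · simp [ht]

/-- Total variation of a functional on a set. -/
def tv (φ : LI ℕ ℝ →L[ℝ] ℝ) (A : Set ℕ) : ℝ :=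
  sSup {r | ∃ a : LI ℕ ℝ, ‖a‖ ≤ 1 ∧ (∀ t ∉ A, a t = 0) ∧ φ a = r}

theorem le_tv (φ : LI ℕ ℝ →L[ℝ] ℝ) (A : Set ℕ) (a : LI ℕ ℝ) (h1 : ‖a‖ ≤ 1)
    (h2 : ∀ t ∉ A, a t = 0) : φ a ≤ tv φ A := by
  refine le_csSup ⟨‖φ‖, ?_⟩ ⟨a, h1, h2, rfl⟩
  rintro _ ⟨b, hb, -, rfl⟩
  have h3 := φ.le_opNorm b
  have h4 := le_abs_self (φ b)
  rw [Real.norm_eq_abs] at h3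
  nlinarith [norm_nonneg φ]

theorem tv_le (φ : LI ℕ ℝ →L[ℝ] ℝ) (A : Set ℕ) (c : ℝ)
    (h : ∀ a : LI ℕ ℝ, ‖a‖ ≤ 1 → (∀ t ∉ A, a t = 0) → φ a ≤ c) : tv φ A ≤ c := by
  refine csSup_le ⟨0, 0, by simp, by simp, by simp⟩ ?_
  rintro _ ⟨a, h1, h2, rfl⟩
  exact h a h1 h2

theorem tv_univ_le (φ : LI ℕ ℝ →L[ℝ] ℝ) : tv φ Set.univ ≤ ‖φ‖ := by
  refine tv_le _ _ _ fun a ha _ => ?_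
  have h3 := φ.le_opNorm a
  have h4 := le_abs_self (φ a)
  rw [Real.norm_eq_abs] at h3
  nlinarith [norm_nonneg φ]

theorem tv_nonneg (φ : LI ℕ ℝ →L[ℝ] ℝ) (A : Set ℕ) : 0 ≤ tv φ A := by
  simpa using le_tv φ A 0 (by simp) (by simp)

theorem abs_le_tv (φ : LI ℕ ℝ →L[ℝ] ℝ) (A : Set ℕ) (a : LI ℕ ℝ)
    (h2 : ∀ t ∉ A, a t = 0) : |φ a| ≤ tv φ A * ‖a‖ := by
  rcases eq_or_ne a 0 with rfl | ha
  · simp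
  have hpos : 0 < ‖a‖ := norm_pos_iff.2 ha
  have h1 : ‖‖a‖⁻¹ • a‖ ≤ 1 := by
    rw [norm_smul, norm_inv, norm_norm, inv_mul_cancel₀ hpos.ne']
  have e1 := le_tv φ A (‖a‖⁻¹ • a) h1 (fun t ht => by
    rw [lp.coeFn_smul, Pi.smul_apply, h2 t ht, smul_zero])
  have e2 := le_tv φ A (-(‖a‖⁻¹ • a)) (by rwa [norm_neg]) (fun t ht => by
    rw [lp.coeFn_neg, Pi.neg_apply, lp.coeFn_smul, Pi.smul_apply, h2 t ht, smul_zero, neg_zero])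
  rw [map_neg] at e2
  rw [map_smul, smul_eq_mul] at e1 e2
  rw [abs_le]
  have e3 : φ a = ‖a‖ * (‖a‖⁻¹ * φ a) := by field_simp
  constructor
  · rw [e3]; nlinarith
  · rw [e3]; nlinarith

theorem tv_FA (φ : LI ℕ ℝ →L[ℝ] ℝ) : FA (tv φ) := by
  refine ⟨tv_nonneg φ, fun A B hAB => le_antisymm ?_ ?_⟩
  · refine tv_le _ _ _ fun a ha hs => ?_
    obtain ⟨r, hr1, hr2⟩ := exists_res A
    have hsub : ∀ t, (a - r a) t = a t - r a t := fun t => by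
      rw [lp.coeFn_sub, Pi.sub_apply]
    have e1 := le_tv φ A (r a) (lp.norm_le_of_forall_le zero_le_one fun t => by
      by_cases ht : t ∈ A
      · rw [hr1 a t ht]; exact (norm_coord_le t a).trans ha
      · rw [hr2 a t ht]; simp) (hr2 a)
    have e2 := le_tv φ B (a - r a) (lp.norm_le_of_forall_le zero_le_one fun t => by
      rw [hsub]
      by_cases ht : t ∈ A
      · rw [hr1 a t ht]; simp
      · rw [hr2 a t ht, sub_zero]; exact (norm_coord_le t a).trans ha) (fun t ht => by
      rw [hsub]
      by_cases hA : t ∈ A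
      · rw [hr1 a t hA]; simp
      · rw [hr2 a t hA, hs t (by simp [hA, ht])]; simp)
    rw [map_sub] at e2
    linarith
  · have key : ∀ a b : LI ℕ ℝ, ‖a‖ ≤ 1 → (∀ t ∉ A, a t = 0) → ‖b‖ ≤ 1 → (∀ t ∉ B, b t = 0) →
        φ a + φ b ≤ tv φ (A ∪ B) := by
      intro a b ha hA hb hB
      rw [← map_add]
      have hadd : ∀ t, (a + b) t = a t + b t := fun t => by
        rw [lp.coeFn_add, Pi.add_apply]
      refine le_tv _ _ _ (lp.norm_le_of_forall_le zero_le_one fun t => ?_) fun t ht => ?_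
      · rw [hadd]
        by_cases ht : t ∈ A
        · rw [hB t (Set.disjoint_left.1 hAB ht), add_zero]
          exact (norm_coord_le t a).trans ha
        · rw [hA t ht, zero_add]
          exact (norm_coord_le t b).trans hb
      · rw [hadd, hA t (fun h => ht (Or.inl h)), hB t (fun h => ht (Or.inr h)), add_zero]
    have h1 : ∀ b : LI ℕ ℝ, ‖b‖ ≤ 1 → (∀ t ∉ B, b t = 0) →
        φ b ≤ tv φ (A ∪ B) - tv φ A := by
      intro b hb hB
      have := tv_le φ A (tv φ (A ∪ B) - φ b) fun a ha hA => by linarith [key a b ha hA hb hB]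
      linarith
    have := tv_le φ B _ h1
    linarith

theorem exists_near_tv (φ : LI ℕ ℝ →L[ℝ] ℝ) (A : Set ℕ) (c : ℝ) (h : c < tv φ A) :
    ∃ a : LI ℕ ℝ, ‖a‖ ≤ 1 ∧ (∀ t ∉ A, a t = 0) ∧ c < φ a := by
  by_contra! hcon
  exact absurd (tv_le φ A c hcon) (not_le.2 h)

/-! ### Finite-dimensionality -/

theorem exists_finite_net {F : Type} [NormedAddCommGroup F] [NormedSpace ℝ F]
    [FiniteDimensional ℝ F] (E : ℕ → F) (hE1 : ∀ t, ‖E t‖ ≤ 1) (δ : ℝ) (hδ : 0 < δ) :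
    ∃ s : Set F, s.Finite ∧ ∀ t, ∃ y ∈ s, dist (E t) y < δ := by
  have hprop : ProperSpace F := FiniteDimensional.proper ℝ F
  have hsub : Set.range E ⊆ Metric.closedBall (0 : F) 1 := by
    rintro _ ⟨t, rfl⟩
    exact mem_closedBall_zero_iff.2 (hE1 t)
  have htb : TotallyBounded (Set.range E) :=
    TotallyBounded.subset hsub (isCompact_closedBall _ 1).totallyBounded
  obtain ⟨s, hs, hcov⟩ := Metric.totallyBounded_iff.1 htb δ hδ
  refine ⟨s, hs, fun t => ?_⟩
  have := hcov ⟨t, rfl⟩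
  simpa using this

theorem finrank_bound_abs {μ : Set ℕ → ℝ} (hμ : FA μ) (τ η : ℝ) (hτ : 0 < τ) (hη : 0 < η)
    {G : Type} [NormedAddCommGroup G] [NormedSpace ℝ G] [FiniteDimensional ℝ G]
    (E : ℕ → (G →L[ℝ] ℝ)) (hE1 : ∀ t, ‖E t‖ ≤ 1)
    (hG : ∀ a : G, ‖a‖ = 1 → τ ≤ μ {t | η < |E t a|}) :
    Module.finrank ℝ G * (τ * (η ^ 2 / 4)) ≤ μ Set.univ := by
  classical
  obtain ⟨s, hs, hr⟩ := exists_finite_net (F := G →L[ℝ] ℝ) E hE1 (η / 4) (by linarith)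
  choose r hrs hrd using hr
  let sF := hs.toFinset
  have hrF : ∀ t, r t ∈ sF := fun t => hs.mem_toFinset.2 (hrs t)
  let c : (G →L[ℝ] ℝ) → Set ℕ := fun y => {t | r t = y}
  have hpt : ∀ y, ∃ p : ℕ, ∀ t ∈ c y, r p = y := fun y => by
    by_cases h : ∃ p, r p = y
    · obtain ⟨p, hp⟩ := h
      exact ⟨p, fun _ _ => hp⟩
    · exact ⟨0, fun t ht => absurd ⟨t, ht⟩ h⟩
  choose pt hpt using hpt
  let w : (G →L[ℝ] ℝ) → ℝ := fun y => μ (c y)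
  have hw : ∀ y, 0 ≤ w y := fun y => hμ.1 _
  have hcd : ∀ y z, y ≠ z → Disjoint (c y) (c z) := fun y z hyz => by
    rw [Set.disjoint_left]
    intro t h1 h2
    exact hyz (h1.symm.trans h2)
  have hwsum : ∀ s' : Finset (G →L[ℝ] ℝ), μ (⋃ y ∈ s', c y) = ∑ y ∈ s', w y := fun s' =>
    hμ.biUnion_eq s' c fun y _ z _ => hcd y z
  -- the discretized inner product
  let Bf : LinearMap.BilinForm ℝ G := LinearMap.mk₂ ℝ
    (fun a b => ∑ y ∈ sF, w y * (E (pt y) a * E (pt y) b))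
    (fun a b d => by
      rw [← Finset.sum_add_distrib]
      exact Finset.sum_congr rfl fun y _ => by rw [map_add]; ring)
    (fun k a b => by
      rw [smul_eq_mul, Finset.mul_sum]
      exact Finset.sum_congr rfl fun y _ => by rw [map_smul, smul_eq_mul]; ring)
    (fun a b d => by
      rw [← Finset.sum_add_distrib]
      exact Finset.sum_congr rfl fun y _ => by rw [map_add]; ring)
    (fun k a b => by
      rw [smul_eq_mul, Finset.mul_sum]
      exact Finset.sum_congr rfl fun y _ => by rw [map_smul, smul_eq_mul]; ring)
  have hBf : ∀ a b, Bf a b = ∑ y ∈ sF, w y * (E (pt y) a * E (pt y) b) := fun a b => rfl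
  clear_value Bf
  have hsymm : LinearMap.IsSymm Bf := ⟨fun a b => by
    simp only [hBf, RingHom.id_apply]
    exact Finset.sum_congr rfl fun y _ => by ring⟩
  have hunit : ∀ a : G, ‖a‖ = 1 → τ * (η ^ 2 / 4) ≤ Bf a a := by
    intro a ha
    have h1 := hG a ha
    let s' := sF.filter fun y => η / 2 < |E (pt y) a|
    have hsub : {t | η < |E t a|} ⊆ ⋃ y ∈ s', c y := by
      intro t ht
      have hpr : r (pt (r t)) = r t := hpt (r t) t rfl
      have hd : dist (E t) (E (pt (r t))) < η / 2 := by
        have e1 := hrd t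
        have e2 := hrd (pt (r t))
        rw [hpr, dist_comm] at e2
        linarith [dist_triangle (E t) (r t) (E (pt (r t)))]
      have hd2 : |E t a - E (pt (r t)) a| ≤ η / 2 := by
        have := (E t - E (pt (r t))).le_opNorm a
        rw [ha, mul_one, ← dist_eq_norm, Real.norm_eq_abs, ContinuousLinearMap.sub_apply] at this
        linarith
      have ht' : η < |E t a| := ht
      have hin : r t ∈ s' := by
        refine Finset.mem_filter.2 ⟨hrF t, ?_⟩
        have := abs_sub_abs_le_abs_sub (E t a) (E (pt (r t)) a)
        linarith
      exact Set.mem_biUnion hin (show t ∈ c (r t) from rfl)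
    have h2 := h1.trans (hμ.mono hsub)
    rw [hwsum] at h2
    calc τ * (η ^ 2 / 4) ≤ (∑ y ∈ s', w y) * (η ^ 2 / 4) := by gcongr
      _ = ∑ y ∈ s', w y * (η ^ 2 / 4) := by rw [Finset.sum_mul]
      _ ≤ ∑ y ∈ s', w y * (E (pt y) a * E (pt y) a) := by
        refine Finset.sum_le_sum fun y hy => mul_le_mul_of_nonneg_left ?_ (hw y)
        have h3 := (Finset.mem_filter.1 hy).2
        have h4 := abs_mul_abs_self (E (pt y) a)
        nlinarith
      _ ≤ ∑ y ∈ sF, w y * (E (pt y) a * E (pt y) a) :=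
        Finset.sum_le_sum_of_subset_of_nonneg (Finset.filter_subset _ _) fun y _ _ =>
          mul_nonneg (hw y) (mul_self_nonneg _)
      _ = Bf a a := (hBf a a).symm
  set κ := τ * (η ^ 2 / 4) with hκ
  have hκ0 : 0 < κ := by positivity
  have hlow : ∀ a : G, κ * ‖a‖ ^ 2 ≤ Bf a a := by
    intro a
    rcases eq_or_ne a 0 with rfl | ha
    · simp
    have hpos : 0 < ‖a‖ := norm_pos_iff.2 ha
    have h1 := hunit (‖a‖⁻¹ • a) (by
      rw [norm_smul, norm_inv, norm_norm, inv_mul_cancel₀ hpos.ne'])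
    simp only [map_smul, LinearMap.smul_apply, smul_eq_mul] at h1
    have h2 : Bf a a = ‖a‖ ^ 2 * (‖a‖⁻¹ * (‖a‖⁻¹ * Bf a a)) := by field_simp
    rw [h2, mul_comm κ]
    gcongr
  obtain ⟨v, hv⟩ := LinearMap.BilinForm.exists_orthogonal_basis hsymm
  have hvo : ∀ i j, i ≠ j → Bf (v i) (v j) = 0 := fun i j hij => hv hij
  let d := fun i => Bf (v i) (v i)
  have hd : ∀ i, 0 < d i := fun i => by
    have h1 := hlow (v i)
    have h2 : 0 < ‖v i‖ := norm_pos_iff.2 (v.ne_zero i)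
    exact lt_of_lt_of_le (by positivity) h1
  let S : ℕ → ℝ := fun t => ∑ i, (E t (v i)) ^ 2 / d i
  have hS : ∀ t, κ * S t ≤ 1 := by
    intro t
    let a : G := ∑ i, (E t (v i) / d i) • v i
    have ha1 : E t a = S t := by
      simp only [a, S, map_sum, map_smul, smul_eq_mul]
      exact Finset.sum_congr rfl fun i _ => by ring
    have ha2 : Bf a a = S t := by
      have : ∀ i, Bf (v i) a = E t (v i) := fun i => by
        simp only [a, map_sum, map_smul, smul_eq_mul]
        rw [Finset.sum_eq_single i]
        · exact div_mul_cancel₀ _ (hd i).ne'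
        · intro j _ hj
          rw [hvo i j hj.symm, mul_zero]
        · simp
      have h2 : Bf a a = ∑ i, (E t (v i) / d i) * Bf (v i) a := by
        conv_lhs => rw [show Bf a = Bf (∑ i, (E t (v i) / d i) • v i) from rfl]
        simp only [map_sum, map_smul, LinearMap.sum_apply, LinearMap.smul_apply, smul_eq_mul]
      rw [h2]
      exact Finset.sum_congr rfl fun i _ => by rw [this]; ring
    have h3 := hlow a
    rw [ha2] at h3
    have h4 : (S t) ^ 2 ≤ ‖a‖ ^ 2 := by
      have h5 := (E t).le_opNorm a
      rw [ha1, Real.norm_eq_abs] at h5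
      have h6 : |S t| ≤ ‖a‖ := h5.trans (by nlinarith [hE1 t, norm_nonneg a])
      rw [← sq_abs (S t)]
      gcongr
    have h0 : 0 ≤ S t := Finset.sum_nonneg fun i _ => div_nonneg (sq_nonneg _) (hd i).le
    rcases h0.eq_or_lt with h | h
    · rw [← h]; simp
    · nlinarith
  have hsum : ∑ y ∈ sF, w y * S (pt y) = Module.finrank ℝ G := by
    calc ∑ y ∈ sF, w y * S (pt y)
        = ∑ y ∈ sF, ∑ i, w y * (E (pt y) (v i) * E (pt y) (v i)) / d i := by
          refine Finset.sum_congr rfl fun y _ => ?_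
          rw [Finset.mul_sum]
          exact Finset.sum_congr rfl fun i _ => by ring
      _ = ∑ i, ∑ y ∈ sF, w y * (E (pt y) (v i) * E (pt y) (v i)) / d i := Finset.sum_comm
      _ = ∑ i : Fin (Module.finrank ℝ G), (1 : ℝ) := by
          refine Finset.sum_congr rfl fun i _ => ?_
          rw [← Finset.sum_div, ← hBf]
          exact div_self (hd i).ne'
      _ = Module.finrank ℝ G := by simp
  rw [← hsum, Finset.sum_mul]
  calc ∑ y ∈ sF, w y * S (pt y) * κ ≤ ∑ y ∈ sF, w y := by
        refine Finset.sum_le_sum fun y _ => ?_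
        nlinarith [hS (pt y), hw y]
    _ = μ (⋃ y ∈ sF, c y) := (hwsum sF).symm
    _ ≤ _ := hμ.mono (Set.subset_univ _)

theorem finrank_bound {μ : Set ℕ → ℝ} (hμ : FA μ) (τ η : ℝ) (hτ : 0 < τ) (hη : 0 < η)
    (G : Submodule ℝ (LI ℕ ℝ)) [FiniteDimensional ℝ G]
    (hG : ∀ a : LI ℕ ℝ, a ∈ G → ‖a‖ = 1 → τ ≤ μ {t | η < |a t|}) :
    Module.finrank ℝ G * (τ * (η ^ 2 / 4)) ≤ μ Set.univ := by
  let E : ℕ → (G →L[ℝ] ℝ) := fun t => (ev t).comp G.subtypeL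
  have hE : ∀ t (a : G), E t a = (a : LI ℕ ℝ) t := fun t a => rfl
  have hE1 : ∀ t, ‖E t‖ ≤ 1 := fun t =>
    ContinuousLinearMap.opNorm_le_bound _ zero_le_one fun a => by
      rw [hE, one_mul]; exact norm_coord_le t (a : LI ℕ ℝ)
  exact finrank_bound_abs hμ τ η hτ hη E hE1 fun a ha => hG a a.2 ha

/-! ### Stability implies complementation -/

theorem complemented {X : Type} [NormedAddCommGroup X] [NormedSpace ℝ X] [Nontrivial X]
    (h : ∀ (Y : Type) [NormedAddCommGroup Y] [NormedSpace ℝ Y] [CompleteSpace Y],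
      PairStable X Y)
    (i : X →L[ℝ] LI ℕ ℝ) (K : ℝ) (hi : ∀ x, ‖x‖ ≤ K * ‖i x‖) :
    ∃ P : LI ℕ ℝ →L[ℝ] X, ∀ x, P (i x) = x := by
  classical
  let Γ := {g : X →L[ℝ] ℝ // ‖g‖ ≤ 1}
  let j : X →L[ℝ] LI Γ ℝ := mkOp (fun g : Γ => g.1) 1 (fun g => g.2)
  have hjn : ∀ x, ‖j x‖ = ‖x‖ := by
    intro x
    apply le_antisymm
    · have := j.le_of_opNorm_le (norm_mkOp_le _ _ _ zero_le_one) x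
      rwa [one_mul] at this
    · obtain ⟨g, hg, hgx⟩ := exists_dual_vector'' ℝ x
      have h1 := norm_coord_le (⟨g, hg⟩ : Γ) (j x)
      have h2 : j x ⟨g, hg⟩ = g x := rfl
      rw [h2, hgx] at h1
      simpa using h1
  clear_value j
  obtain ⟨S, hS⟩ := hb_extend i K hi j
  -- surjection onto the ball
  obtain ⟨G, hG1, hGs, hG0⟩ : ∃ G : X → LI ℕ ℝ, (∀ x, ‖G x‖ ≤ 1) ∧
      (∀ b, ‖b‖ ≤ 1 → ∃ x, G x = b) ∧ G 0 = 0 := by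
    let B := {b : LI ℕ ℝ // ‖b‖ ≤ 1}
    let z : B := ⟨0, by simp⟩
    have hcard : Cardinal.mk B ≤ Cardinal.mk X := by
      have h1 : Cardinal.mk B ≤ Cardinal.mk (ℕ → ℝ) :=
        Cardinal.mk_le_of_injective (f := fun b : B => (b.1 : ℕ → ℝ))
          (fun a b hab => Subtype.ext (lp.ext hab))
      have h2 : Cardinal.mk (ℕ → ℝ) = Cardinal.continuum := by
        simp [Cardinal.mk_real]
      rw [h2] at h1
      exact h1.trans (continuum_le_cardinal_of_module ℝ X)
    obtain ⟨emb⟩ := hcard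
    have : Nonempty B := ⟨z⟩
    let g : X → B := Function.invFun emb
    have hg : Function.Surjective g := Function.invFun_surjective emb.injective
    let sw := Equiv.swap (g 0) z
    refine ⟨fun x => (sw (g x)).1, fun x => (sw (g x)).2, fun b hb => ?_, ?_⟩
    · obtain ⟨x, hx⟩ := hg (sw.symm ⟨b, hb⟩)
      exact ⟨x, by simp only [hx, Equiv.apply_symm_apply]⟩
    · simp only [sw, Equiv.swap_apply_left]
      rfl
  let c : ℝ := 1 / (2 * ‖S‖ + 1)
  have hc0 : 0 < c := by positivity
  have hc1 : c * (‖S‖ * 2) ≤ 1 := by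
    simp only [c]
    rw [one_div, inv_mul_le_iff₀ (by positivity)]
    linarith
  let f : X → LI Γ ℝ := fun x => j x + c • S (G x)
  have hf : ∀ x, f x = j x + c • S (G x) := fun x => rfl
  have hSG : ∀ x, ‖c • S (G x)‖ ≤ 1 := fun x => by
    rw [norm_smul, Real.norm_of_nonneg hc0.le]
    have h1 := S.le_opNorm (G x)
    have h2 : ‖S (G x)‖ ≤ ‖S‖ * 2 := h1.trans (by
      have := hG1 x
      have := norm_nonneg S
      nlinarith)
    exact (mul_le_mul_of_nonneg_left h2 hc0.le).trans hc1
  clear_value f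
  have hstd : StdEpsIsom 1 f := by
    refine ⟨by simp [hf, hG0], fun x y => ?_⟩
    have e1 : f x - f y - j (x - y) = c • S (G x - G y) := by
      rw [hf, hf, map_sub, map_sub, smul_sub]; abel
    have e2 : ‖c • S (G x - G y)‖ ≤ 1 := by
      rw [norm_smul, Real.norm_of_nonneg hc0.le]
      have h1 := S.le_opNorm (G x - G y)
      have h2 : ‖S (G x - G y)‖ ≤ ‖S‖ * 2 := h1.trans (by
        have h3 := norm_sub_le (G x) (G y)
        have := hG1 x
        have := hG1 y
        have := norm_nonneg S
        gcongr
        linarith)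
      exact (mul_le_mul_of_nonneg_left h2 hc0.le).trans hc1
    rw [← hjn (x - y)]
    have e3 := abs_norm_sub_norm_le (f x - f y) (j (x - y))
    rw [e1] at e3
    exact e3.trans e2
  obtain ⟨α, γ, hα, hγ, T, hT, hTx⟩ := h (LI Γ ℝ) 1 one_pos f hstd
  have hscal : ∀ (n : ℕ) x, f ((n : ℝ) • x) = (n : ℝ) • j x + c • S (G ((n : ℝ) • x)) :=
    fun n x => by rw [hf, map_smul]
  have hjL : ∀ x, j x ∈ Lf f := by
    intro x
    have hcl : IsClosed (Lf f : Set (LI Γ ℝ)) := Submodule.isClosed_topologicalClosure _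
    have hlim : Filter.Tendsto (fun n : ℕ => ((n : ℝ) + 1)⁻¹ • f (((n + 1 : ℕ) : ℝ) • x))
        Filter.atTop (nhds (j x)) := by
      rw [tendsto_iff_norm_sub_tendsto_zero]
      refine squeeze_zero (fun _ => norm_nonneg _) (fun n => ?_)
        (tendsto_one_div_add_atTop_nhds_zero_nat (𝕜 := ℝ))
      have hn : (0 : ℝ) < (n : ℝ) + 1 := by positivity
      rw [hscal, smul_add, smul_smul, Nat.cast_succ, inv_mul_cancel₀ hn.ne', one_smul,
        add_sub_cancel_left, norm_smul, norm_inv, Real.norm_of_nonneg hn.le, one_div]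
      have := hSG (((n : ℝ) + 1) • x)
      have h3 : (0 : ℝ) ≤ ((n : ℝ) + 1)⁻¹ := by positivity
      nlinarith
    refine hcl.mem_of_tendsto hlim (Filter.Eventually.of_forall fun n => ?_)
    exact (Lf f).smul_mem _ (mem_Lf f _)
  have hcSG : ∀ x, c • S (G x) ∈ Lf f := fun x => by
    have := (Lf f).sub_mem (mem_Lf f x) (hjL x)
    rwa [hf, add_sub_cancel_left] at this
  have hSL : ∀ b, S b ∈ Lf f := by
    intro b
    rcases eq_or_ne b 0 with rfl | hb
    · rw [map_zero]; exact (Lf f).zero_mem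
    have hpos : 0 < ‖b‖ := norm_pos_iff.2 hb
    obtain ⟨x, hx⟩ := hGs (‖b‖⁻¹ • b) (by
      rw [norm_smul, norm_inv, norm_norm, inv_mul_cancel₀ hpos.ne'])
    have h1 := (Lf f).smul_mem (‖b‖ * c⁻¹) (hcSG x)
    rw [smul_smul, hx, map_smul, smul_smul] at h1
    have : ‖b‖ * c⁻¹ * c * ‖b‖⁻¹ = 1 := by field_simp
    rwa [this, one_smul] at h1
  refine ⟨T.comp (S.codRestrict (Lf f) hSL), fun x => ?_⟩
  have hval : (T.comp (S.codRestrict (Lf f) hSL)) (i x) = T ⟨j x, hjL x⟩ := by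
    change T _ = T _
    congr 1
    exact Subtype.ext (hS x)
  rw [hval]
  have hbd : ∀ n : ℕ, (n : ℝ) * ‖T ⟨j x, hjL x⟩ - x‖ ≤ γ + α := by
    intro n
    have h1 := hTx ((n : ℝ) • x)
    have h2 : (⟨f ((n : ℝ) • x), mem_Lf f _⟩ : Lf f) =
        (n : ℝ) • ⟨j x, hjL x⟩ + ⟨c • S (G ((n : ℝ) • x)), hcSG _⟩ :=
      Subtype.ext (hscal n x)
    rw [h2, map_add, map_smul] at h1
    have h3 : ‖T ⟨c • S (G ((n : ℝ) • x)), hcSG _⟩‖ ≤ α := by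
      have h4 := T.le_of_opNorm_le hT ⟨c • S (G ((n : ℝ) • x)), hcSG _⟩
      have h5 : ‖(⟨c • S (G ((n : ℝ) • x)), hcSG _⟩ : Lf f)‖ ≤ 1 := hSG _
      nlinarith
    have h6 : (n : ℝ) • (T ⟨j x, hjL x⟩ - x) =
        ((n : ℝ) • T ⟨j x, hjL x⟩ + T ⟨c • S (G ((n : ℝ) • x)), hcSG _⟩ - (n : ℝ) • x) -
          T ⟨c • S (G ((n : ℝ) • x)), hcSG _⟩ := by
      rw [smul_sub]; abel
    have h7 : ‖(n : ℝ) • (T ⟨j x, hjL x⟩ - x)‖ = (n : ℝ) * ‖T ⟨j x, hjL x⟩ - x‖ := by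
      rw [norm_smul, Real.norm_of_nonneg (Nat.cast_nonneg n)]
    rw [← h7, h6]
    refine (norm_sub_le _ _).trans ?_
    linarith
  by_contra hne
  have hpos : 0 < ‖T ⟨j x, hjL x⟩ - x‖ := norm_pos_iff.2 (sub_ne_zero.2 hne)
  obtain ⟨n, hn⟩ := exists_nat_gt ((γ + α) / ‖T ⟨j x, hjL x⟩ - x‖)
  rw [div_lt_iff₀ hpos] at hn
  linarith [hbd n]

/-! ### Copies of `ℓ∞` -/

theorem exists_copy {X : Type} [NormedAddCommGroup X] [NormedSpace ℝ X]
    (i : X →L[ℝ] LI ℕ ℝ) (P : LI ℕ ℝ →L[ℝ] X) (B : ℕ → Set ℕ) (k : ℕ → ℕ)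
    (hB : ∀ i j, i ≠ j → Disjoint (B i) (B j))
    (hk : ∀ n, 1 / 4 ≤ tv ((ev (k n)).comp (i.comp P)) (B n)) :
    ∃ (U : LI ℕ ℝ →L[ℝ] X) (K : ℝ), ∀ a, ‖a‖ ≤ K * ‖U a‖ := by
  classical
  let φ : ℕ → LI ℕ ℝ →L[ℝ] ℝ := fun n => (ev (k n)).comp (i.comp P)
  have hφ : ∀ n a, |φ n a| ≤ ‖i‖ * ‖P a‖ := fun n a => by
    have h1 := norm_coord_le (k n) (i (P a))
    exact h1.trans (i.le_opNorm _)
  have hφn : ∀ n, ‖φ n‖ ≤ ‖i‖ * ‖P‖ := fun n => by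
    refine ContinuousLinearMap.opNorm_le_bound _ (by positivity) fun a => ?_
    refine (hφ n a).trans ?_
    rw [mul_assoc]
    gcongr
    exact P.le_opNorm a
  have hk' : ∀ n, 1 / 4 ≤ tv (φ n) (B n) := hk
  clear_value φ
  let ν : ℕ → Set ℕ → ℝ := fun n A => tv (φ n) (⋃ m ∈ A, B m)
  have hν : ∀ n, FA (ν n) := fun n => by
    refine ⟨fun A => tv_nonneg _ _, fun A A' hd => ?_⟩
    simp only [ν]
    rw [Set.biUnion_union]
    refine (tv_FA (φ n)).2 _ _ ?_
    rw [Set.disjoint_iUnion₂_left]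
    intro m hm
    rw [Set.disjoint_iUnion₂_right]
    intro m' hm'
    exact hB m m' fun e => Set.disjoint_left.1 hd hm (e ▸ hm')
  obtain ⟨N, hN⟩ := exists_nat_ge (‖i‖ * ‖P‖ / (1 / 16))
  rw [div_le_iff₀ (by norm_num)] at hN
  obtain ⟨M, hMinf, hM⟩ := rosenthal ν hν (1 / 16) (by norm_num) N Set.univ Set.infinite_univ
    (fun n _ => ((tv_FA (φ n)).mono (Set.subset_univ _)).trans
      ((tv_univ_le (φ n)).trans ((hφn n).trans hN)))
  choose x hx1 hxs hxφ using fun n => exists_near_tv (φ n) (B n) (1 / 8)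
    (lt_of_lt_of_le (by norm_num) (hk' n))
  let σ : ℕ → ℕ := fun n => hMinf.natEmbedding M n
  have hσ : ∀ n, σ n ∈ M := fun n => (hMinf.natEmbedding M n).2
  have hσi : ∀ n m, σ n = σ m → n = m := fun n m hnm =>
    (hMinf.natEmbedding M).injective (Subtype.ext hnm)
  clear_value σ
  obtain ⟨J, hJ1, hJ2⟩ : ∃ J : LI ℕ ℝ →L[ℝ] LI ℕ ℝ,
      (∀ a n, ∀ t ∈ B (σ n), J a t = a n * x (σ n) t) ∧
      (∀ a t, (∀ n, t ∉ B (σ n)) → J a t = 0) := by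
    have hq : ∀ t, ∃ q : LI ℕ ℝ →L[ℝ] ℝ, ‖q‖ ≤ 1 ∧
        (∀ a n, t ∈ B (σ n) → q a = a n * x (σ n) t) ∧
        (∀ a, (∀ n, t ∉ B (σ n)) → q a = 0) := by
      intro t
      by_cases ht : ∃ n, t ∈ B (σ n)
      · obtain ⟨n, hn⟩ := ht
        refine ⟨x (σ n) t • ev n, ?_, fun a m hm => ?_, fun a h => absurd hn (h n)⟩
        · rw [norm_smul]
          exact mul_le_one₀ ((norm_coord_le t _).trans (hx1 _)) (norm_nonneg _) (norm_ev_le _)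
        · have : m = n := by
            by_contra hne
            exact Set.disjoint_left.1 (hB _ _ fun e => hne (hσi _ _ e)) hm hn
          subst this
          simp [mul_comm]
      · push Not at ht
        exact ⟨0, by simp, fun a n hn => absurd hn (ht n), fun a _ => rfl⟩
    choose q hq1 hq2 hq3 using hq
    exact ⟨mkOp q 1 hq1, fun a n t ht => hq2 t a n ht, fun a t h => hq3 t a h⟩
  have hmul : ∀ (a : LI ℕ ℝ) n m t, ‖a n * x m t‖ ≤ ‖a‖ := fun a n m t => by
    rw [norm_mul]
    have h1 := norm_coord_le n a
    have h2 := (norm_coord_le t (x m)).trans (hx1 m)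
    have := norm_nonneg (a n)
    nlinarith
  refine ⟨P.comp J, 16 * ‖i‖, fun a => ?_⟩
  have hcoord : ∀ n, ‖a n‖ ≤ 8 * (‖i‖ * ‖P (J a)‖) + ‖a‖ / 2 := by
    intro n
    let b : LI ℕ ℝ := J a - a n • x (σ n)
    have hb : ∀ t, b t = J a t - a n * x (σ n) t := fun t => by
      simp only [b]
      rw [lp.coeFn_sub, Pi.sub_apply, lp.coeFn_smul, Pi.smul_apply, smul_eq_mul]
    have hb0 : ∀ t ∈ B (σ n), b t = 0 := fun t ht => by
      rw [hb, hJ1 a n t ht, sub_self]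
    have hb1 : ∀ t ∉ B (σ n), b t = J a t := fun t ht => by
      rw [hb, hxs (σ n) t ht, mul_zero, sub_zero]
    have hbn : ‖b‖ ≤ ‖a‖ := by
      refine lp.norm_le_of_forall_le (norm_nonneg _) fun t => ?_
      by_cases ht : t ∈ B (σ n)
      · rw [hb0 t ht, norm_zero]; exact norm_nonneg _
      · rw [hb1 t ht]
        by_cases hm : ∃ m, t ∈ B (σ m)
        · obtain ⟨m, hm⟩ := hm
          rw [hJ1 a m t hm]
          exact hmul a m (σ m) t
        · push Not at hm
          rw [hJ2 a t hm, norm_zero]; exact norm_nonneg _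
    have hbs : ∀ t ∉ ⋃ m ∈ M \ {σ n}, B m, b t = 0 := by
      intro t ht
      by_cases h1 : t ∈ B (σ n)
      · exact hb0 t h1
      rw [hb1 t h1]
      refine hJ2 a t fun m hm => ht ?_
      refine Set.mem_biUnion (x := σ m) ⟨hσ m, fun e => h1 ?_⟩ hm
      rw [← (show σ m = σ n from e)]
      exact hm
    have e1 := abs_le_tv (φ (σ n)) _ b hbs
    have e2 : tv (φ (σ n)) (⋃ m ∈ M \ {σ n}, B m) ≤ 1 / 16 := hM (σ n) (hσ n)
    have e3 : |φ (σ n) b| ≤ ‖a‖ / 16 := by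
      have := norm_nonneg b
      nlinarith
    have e4 : φ (σ n) (J a) = a n * φ (σ n) (x (σ n)) + φ (σ n) b := by
      simp only [b]
      rw [map_sub, map_smul, smul_eq_mul]; ring
    have e5 := hφ (σ n) (J a)
    have e6 : |a n * φ (σ n) (x (σ n))| ≤ ‖i‖ * ‖P (J a)‖ + ‖a‖ / 16 := by
      have : a n * φ (σ n) (x (σ n)) = φ (σ n) (J a) - φ (σ n) b := by rw [e4]; ring
      rw [this]
      exact (abs_sub _ _).trans (add_le_add e5 e3)
    rw [abs_mul] at e6
    have e7 : 1 / 8 ≤ |φ (σ n) (x (σ n))| := (hxφ (σ n)).le.trans (le_abs_self _)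
    rw [Real.norm_eq_abs]
    have := abs_nonneg (a n)
    nlinarith
  have := lp.norm_le_of_forall_le (f := a) (by positivity) hcoord
  rw [ContinuousLinearMap.comp_apply]
  linarith

theorem fd_of_subsingleton {V : Type} [AddCommGroup V] [Module ℝ V] (W : Submodule ℝ V)
    (h : Subsingleton W) : FiniteDimensional ℝ W := inferInstance

theorem exists_big_submodule {V : Type} [AddCommGroup V] [Module ℝ V] (W : Submodule ℝ V) (hW : ¬ FiniteDimensional ℝ W) (n : ℕ) :
    ∃ G : Submodule ℝ V, G ≤ W ∧ FiniteDimensional ℝ G ∧ Module.finrank ℝ G = n := by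
  have hr : (n : Cardinal) ≤ Module.rank ℝ W := by
    have : Cardinal.aleph0 ≤ Module.rank ℝ W := by
      by_contra hlt
      exact hW (Module.rank_lt_aleph0_iff.1 (not_le.1 hlt))
    exact (Cardinal.natCast_lt_aleph0).le.trans this
  obtain ⟨s, hs, hli⟩ := le_rank_iff_exists_linearIndependent_finset.1 hr
  let G0 : Submodule ℝ W := Submodule.span ℝ (s : Set W)
  have hfd : FiniteDimensional ℝ G0 := FiniteDimensional.span_finset ℝ s
  have hfr : Module.finrank ℝ G0 = n := by
    rw [← hs]; exact finrank_span_finset_eq_card hli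
  refine ⟨G0.map W.subtype, Submodule.map_subtype_le _ _, inferInstance, ?_⟩
  rw [← hfr]
  exact (Submodule.equivMapOfInjective W.subtype W.injective_subtype G0).finrank_eq.symm

theorem stmt7_aux {X : Type} [NormedAddCommGroup X] [NormedSpace ℝ X]
    (W : Submodule ℝ (LI ℕ ℝ))
    (hWinf : ¬ FiniteDimensional ℝ W) (i : X →L[ℝ] LI ℕ ℝ) (hiW : ∀ a ∈ W, ∃ x, i x = a)
    (P : LI ℕ ℝ →L[ℝ] X) (hP : ∀ x, P (i x) = x) :
    Nonempty (X ≃L[ℝ] LI ℕ ℝ) := by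
  let φ : ℕ → LI ℕ ℝ →L[ℝ] ℝ := fun n => (ev n).comp (i.comp P)
  have hφ : ∀ n a, φ n a = i (P a) n := fun n a => rfl
  have hφn : ∀ n, ‖φ n‖ ≤ ‖i.comp P‖ := fun n => by
    refine ContinuousLinearMap.opNorm_le_bound _ (by positivity) fun a => ?_
    rw [hφ]
    exact (norm_coord_le n _).trans ((i.comp P).le_opNorm a)
  have hC : ∀ n, tv (φ n) Set.univ ≤ ‖i.comp P‖ := fun n => (tv_univ_le _).trans (hφn n)
  rcases dichotomy (ν := fun n => tv (φ n)) (fun n => tv_FA _) hC (δ := 1 / 2) (by norm_num) with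
    ⟨F, τ, hτ, hF⟩ | ⟨B, k, hB, hk⟩
  · exfalso
    let C := ‖i.comp P‖
    have hC0 : 0 ≤ C := norm_nonneg _
    let η : ℝ := 1 / (4 * (C + 1))
    have hη : 0 < η := by positivity
    have hCη : C * η ≤ 1 / 4 := by
      simp only [η]
      rw [mul_one_div, div_le_iff₀ (by positivity)]
      linarith
    let μ : Set ℕ → ℝ := fun A => ∑ n ∈ F, tv (φ n) A
    have hμ : FA μ := by
      refine ⟨fun A => Finset.sum_nonneg fun n _ => tv_nonneg _ _, fun A B hAB => ?_⟩
      simp only [μ]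
      rw [← Finset.sum_add_distrib]
      exact Finset.sum_congr rfl fun n _ => (tv_FA (φ n)).2 A B hAB
    have hW : ∀ a ∈ W, ‖a‖ = 1 → τ ≤ μ {t | η < |a t|} := by
      intro a ha ha1
      by_contra! hlt
      have hsmall := hF {t | η < |a t|} (fun n hn =>
        lt_of_le_of_lt (Finset.single_le_sum (f := fun n => tv (φ n) {t | η < |a t|})
          (fun n _ => tv_nonneg _ _) hn) hlt)
      obtain ⟨x, rfl⟩ := hiW a ha
      obtain ⟨r, hr1, hr2⟩ := exists_res {t | η < |i x t|}
      have h34 : ‖i x‖ ≤ 3 / 4 := by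
        refine lp.norm_le_of_forall_le (by norm_num) fun n => ?_
        have e0 : i x n = φ n (r (i x)) + φ n (i x - r (i x)) := by
          rw [← map_add, add_sub_cancel, hφ, hP]
        have e1 := abs_le_tv (φ n) _ (r (i x)) (hr2 (i x))
        have e2 : ‖r (i x)‖ ≤ 1 := lp.norm_le_of_forall_le zero_le_one fun t => by
          by_cases ht : t ∈ {t | η < |i x t|}
          · rw [hr1 _ t ht, ← ha1]; exact norm_coord_le t _
          · rw [hr2 _ t ht]; simp
        have e3 : ‖i x - r (i x)‖ ≤ η := lp.norm_le_of_forall_le hη.le fun t => by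
          rw [lp.coeFn_sub, Pi.sub_apply]
          by_cases ht : t ∈ {t | η < |i x t|}
          · rw [hr1 _ t ht]; simpa using hη.le
          · rw [hr2 _ t ht, sub_zero]
            exact not_lt.1 ht
        have e4 := (φ n).le_opNorm (i x - r (i x))
        rw [Real.norm_eq_abs] at e4
        have e5 : |φ n (i x - r (i x))| ≤ C * η :=
          e4.trans (mul_le_mul (hφn n) e3 (norm_nonneg _) hC0)
        have e6 := hsmall n
        have e7 := tv_nonneg (φ n) {t | η < |i x t|}
        rw [e0, Real.norm_eq_abs]
        refine (abs_add_le _ _).trans ?_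
        have e8 : |φ n (r (i x))| ≤ 1 / 2 := by
          have := norm_nonneg (r (i x))
          simp only at e6
          nlinarith
        linarith
      linarith
    obtain ⟨N, hN⟩ := exists_nat_gt (μ Set.univ / (τ * (η ^ 2 / 4)))
    rw [div_lt_iff₀ (by positivity)] at hN
    obtain ⟨G, hGW, hGfd, hGr⟩ := exists_big_submodule W hWinf N
    have := finrank_bound hμ τ η hτ hη G (fun a ha => hW a (hGW ha))
    rw [hGr] at this
    linarith
  · obtain ⟨U, K, hU⟩ := exists_copy i P B k hB (fun n => by
      have h1 : (1 / 2 : ℝ) / 2 ≤ tv ((ev (k n)).comp (i.comp P)) (B n) := hk n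
      linarith)
    obtain ⟨R, hR⟩ := hb_extend U K hU (ContinuousLinearMap.id ℝ (LI ℕ ℝ))
    exact decomposition i P hP U R hR

/-- A Banach space isomorphic to an infinite-dimensional closed subspace of `ℓ∞` which is
universally left-stable is isomorphic to `ℓ∞`. -/
theorem stmt7 {X : Type} [NormedAddCommGroup X] [NormedSpace ℝ X] [CompleteSpace X]
    (W : Submodule ℝ ellInfty) (hWc : IsClosed (W : Set ellInfty))
    (hWinf : ¬ FiniteDimensional ℝ W) (e : X ≃L[ℝ] W)
    (h : ∀ (Y : Type) [NormedAddCommGroup Y] [NormedSpace ℝ Y] [CompleteSpace Y],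
      PairStable X Y) :
    Nonempty (X ≃L[ℝ] ellInfty) := by
  let i : X →L[ℝ] LI ℕ ℝ := W.subtypeL.comp (e : X →L[ℝ] W)
  have hi : ∀ x, ‖x‖ ≤ ‖(e.symm : W →L[ℝ] X)‖ * ‖i x‖ := fun x => by
    have := (e.symm : W →L[ℝ] X).le_opNorm (e x)
    rw [show (e.symm : W →L[ℝ] X) (e x) = x from e.symm_apply_apply x] at this
    exact this
  have hiW : ∀ a ∈ W, ∃ x, i x = a := fun a ha => ⟨e.symm ⟨a, ha⟩, by simp [i]⟩
  have hnt : Nontrivial X := by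
    by_contra hcon
    rw [not_nontrivial_iff_subsingleton] at hcon
    apply hWinf
    exact fd_of_subsingleton W e.symm.injective.subsingleton
  obtain ⟨P, hP⟩ := complemented h i _ hi
  exact stmt7_aux W hWinf i hiW P hP
end
end

section
/- Let X be a real Banach space and let T : X → ℓ∞ be a bounded linear bijection onto ℓ∞ with bounded inverse, and set λ = ‖T‖·‖T⁻¹‖. Then X is universally (λ, 4λ)-left-stable: for every real Banach space Y, every ε > 0, and every standard ε-isometry f : X → Y, there exists a bounded linear operator S : L(f) → X with ‖S‖ ≤ λ such that ‖S(f(x)) − x‖ ≤ 4λε for all x ∈ X. -/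
open scoped ENNReal ZeroAtInfty

noncomputable section

universe v

open Filter Topology in
theorem norm_asymp {E : Type*} [NormedAddCommGroup E] [NormedSpace ℝ E] {b : E}
    (hb : DifferentiableAt ℝ (fun x : E => ‖x‖) b) (v : E) :
    Tendsto (fun t : ℝ => ‖t • b + v‖ - t * ‖b‖) atTop
      (𝓝 (fderiv ℝ (fun x : E => ‖x‖) b v)) := by
  have h := hb.hasFDerivAt.lim v (c := fun t : ℝ => t) (l := atTop)
    (tendsto_norm_atTop_atTop)
  refine h.congr' ?_
  filter_upwards [eventually_gt_atTop (0 : ℝ)] with t ht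
  have : t • b + v = t • (b + t⁻¹ • v) := by
    rw [smul_add, smul_smul, mul_inv_cancel₀ ht.ne', one_smul]
  rw [this, norm_smul, Real.norm_of_nonneg ht.le, smul_eq_mul, mul_sub]

open Filter Topology in
theorem key_smooth {X Y : Type*} [NormedAddCommGroup X] [NormedSpace ℝ X]
    [NormedAddCommGroup Y] [NormedSpace ℝ Y] {ε : ℝ} {f : X → Y} (hf : StdEpsIsom ε f)
    (E : Submodule ℝ X) (b : E) (hb : DifferentiableAt ℝ (fun x : E => ‖x‖) b)
    (s : Finset X) (hs : ∀ x ∈ s, x ∈ E) (a : X → ℝ) (u : E) (hu : (u : X) = ∑ x ∈ s, a x • x) :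
    ‖b‖ - ‖b - u‖ ≤ ‖∑ x ∈ s, a x • f x‖ + 3 * ε * ∑ x ∈ s, |a x| := by
  obtain ⟨h0, hf⟩ := hf
  set G := fderiv ℝ (fun x : E => ‖x‖) b with hG
  have hGle : ∀ v : E, G v ≤ ‖v‖ := by
    intro v
    refine le_of_tendsto (norm_asymp hb v) ?_
    filter_upwards [eventually_gt_atTop (0 : ℝ)] with t ht
    have := norm_add_le (t • b) v
    rw [norm_smul, Real.norm_of_nonneg ht.le] at this
    linarith
  have hGb : G b = ‖b‖ := by
    refine tendsto_nhds_unique (norm_asymp hb b) (tendsto_const_nhds.congr' ?_)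
    filter_upwards [eventually_gt_atTop (0 : ℝ)] with t ht
    have : t • b + b = (t + 1) • b := by rw [add_smul, one_smul]
    rw [this, norm_smul, Real.norm_of_nonneg (by linarith)]
    ring
  have hGu : ‖b‖ - ‖b - u‖ ≤ G u := by
    have := hGle (b - u)
    rw [map_sub, hGb] at this
    linarith
  classical
  let g : X → ℝ := fun x => if h : x ∈ E then G ⟨x, h⟩ else 0
  have hgu : G u = ∑ x ∈ s, a x * g x := by
    have : u = ∑ x ∈ s.attach, a x.1 • (⟨x.1, hs x.1 x.2⟩ : E) := by
      apply Subtype.ext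
      rw [hu, Submodule.coe_sum]
      rw [← Finset.sum_attach]
      rfl
    rw [this, map_sum, ← Finset.sum_attach s (fun x => a x * g x)]
    refine Finset.sum_congr rfl fun x _ => ?_
    rw [map_smul, smul_eq_mul]
    simp only [g, dif_pos (hs x.1 x.2)]
  -- eventual estimates
  have hev : ∀ δ > 0, ∀ x ∈ s, ∀ᶠ t : ℝ in atTop,
      ‖t • (b : X) + x‖ - t * ‖b‖ < g x + δ ∧ ‖t • (b : X) - x‖ - t * ‖b‖ < - g x + δ := by
    intro δ hδ x hx
    have h1 := (norm_asymp hb ⟨x, hs x hx⟩).eventually_lt_const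
      (show _ < g x + δ by simp only [g, dif_pos (hs x hx)]; linarith)
    have h2 := (norm_asymp hb (-⟨x, hs x hx⟩)).eventually_lt_const
      (show _ < - g x + δ by simp only [g, dif_pos (hs x hx), map_neg]; linarith)
    filter_upwards [h1, h2] with t h1 h2
    refine ⟨h1, ?_⟩
    rw [← sub_eq_add_neg] at h2
    exact h2
  have main : ∀ δ > 0, G u ≤ ‖∑ x ∈ s, a x • f x‖ + (3 * ε + δ) * ∑ x ∈ s, |a x| := by
    intro δ hδ
    have h := (Finset.eventually_all s).2 (hev δ hδ)
    obtain ⟨t, h, ht⟩ := (h.and (eventually_gt_atTop (0 : ℝ))).exists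
    obtain ⟨φ, hφ, hφe⟩ := exists_dual_vector'' ℝ (f (t • (b : X)) - f (-(t • (b : X))))
    have hφle : ∀ y, φ y ≤ ‖y‖ := fun y =>
      (le_abs_self _).trans ((φ.le_of_opNorm_le hφ y).trans (by simp))
    have hnb : ‖t • (b : X)‖ = t * ‖b‖ := by
      rw [norm_smul, Real.norm_of_nonneg ht.le]; rfl
    have e1 := (abs_le.1 (hf (t • (b : X)) (-(t • (b : X))))).1
    have e1' : ‖t • (b : X) - (-(t • (b : X)))‖ = 2 * (t * ‖b‖) := by
      rw [sub_neg_eq_add, ← two_smul ℝ, norm_smul, hnb]; norm_num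
    rw [e1'] at e1
    have e2 : φ (f (t • (b : X))) - φ (f (-(t • (b : X)))) ≥ 2 * (t * ‖b‖) - ε := by
      rw [← map_sub, hφe]
      simp at e1 ⊢
      linarith
    have e3 : φ (f (t • (b : X))) ≤ t * ‖b‖ + ε := by
      have h1 := hφle (f (t • (b : X)))
      have h2 := (abs_le.1 (hf (t • (b : X)) 0)).2
      rw [h0, sub_zero, sub_zero, hnb] at h2
      linarith
    have e4 : - φ (f (-(t • (b : X)))) ≤ t * ‖b‖ + ε := by
      have h1 := hφle (-f (-(t • (b : X))))
      have h2 := (abs_le.1 (hf (-(t • (b : X))) 0)).2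
      rw [h0, sub_zero, sub_zero, norm_neg, hnb] at h2
      rw [norm_neg, map_neg] at h1
      linarith
    have hx : ∀ x ∈ s, |φ (f x) - g x| ≤ 3 * ε + δ := by
      intro x hx
      obtain ⟨k1, k2⟩ := h x hx
      have l1 := hφle (f (t • (b : X)) - f x)
      have l2 := (abs_le.1 (hf (t • (b : X)) x)).2
      have l3 := hφle (f x - f (-(t • (b : X))))
      have l4 := (abs_le.1 (hf x (-(t • (b : X))))).2
      rw [sub_neg_eq_add, add_comm x] at l4
      rw [map_sub] at l1 l3
      rw [abs_le]
      constructor <;> linarith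
    have hsum : φ (∑ x ∈ s, a x • f x) = ∑ x ∈ s, a x * φ (f x) := by
      simp [map_sum]
    have hle := hφle (∑ x ∈ s, a x • f x)
    rw [hsum] at hle
    have : ∑ x ∈ s, a x * g x - ∑ x ∈ s, a x * φ (f x) ≤ (3 * ε + δ) * ∑ x ∈ s, |a x| := by
      rw [← Finset.sum_sub_distrib, Finset.mul_sum]
      refine Finset.sum_le_sum fun x hxs => ?_
      rw [← mul_sub]
      refine (le_abs_self _).trans ?_
      rw [abs_mul, mul_comm, abs_sub_comm]
      exact mul_le_mul_of_nonneg_right (hx x hxs) (abs_nonneg _)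
    rw [hgu]
    linarith
  refine hGu.trans ?_
  have hlim : Tendsto (fun δ : ℝ => ‖∑ x ∈ s, a x • f x‖ + (3 * ε + δ) * ∑ x ∈ s, |a x|)
      (𝓝[>] 0) (𝓝 (‖∑ x ∈ s, a x • f x‖ + (3 * ε + 0) * ∑ x ∈ s, |a x|)) := by
    refine Tendsto.mono_left (Continuous.tendsto (by fun_prop) 0) nhdsWithin_le_nhds
  rw [add_zero] at hlim
  exact ge_of_tendsto hlim (by filter_upwards [self_mem_nhdsWithin] with δ hδ using main δ hδ)

theorem key_ineq {X Y : Type*} [NormedAddCommGroup X] [NormedSpace ℝ X]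
    [NormedAddCommGroup Y] [NormedSpace ℝ Y] {ε : ℝ} {f : X → Y} (hf : StdEpsIsom ε f)
    (s : Finset X) (a : X → ℝ) :
    ‖∑ x ∈ s, a x • x‖ ≤ ‖∑ x ∈ s, a x • f x‖ + 3 * ε * ∑ x ∈ s, |a x| := by
  let E : Submodule ℝ X := Submodule.span ℝ (s : Set X)
  have hs : ∀ x ∈ s, x ∈ E := fun x hx => Submodule.subset_span hx
  let u : E := ⟨∑ x ∈ s, a x • x, Submodule.sum_mem _ fun x hx => E.smul_mem _ (hs x hx)⟩
  have : FiniteDimensional ℝ E := FiniteDimensional.span_finset ℝ s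
  have hd := dense_differentiableAt_norm (E := E)
  have hcl : IsClosed {b : E | ‖b‖ - ‖b - u‖ ≤
      ‖∑ x ∈ s, a x • f x‖ + 3 * ε * ∑ x ∈ s, |a x|} :=
    isClosed_le (by fun_prop) continuous_const
  have hall := hcl.closure_subset_iff.2 (fun b hb => key_smooth hf E b hb s hs a u rfl)
    (hd u)
  simpa using hall

theorem weak_stab {X Y : Type*} [NormedAddCommGroup X] [NormedSpace ℝ X]
    [NormedAddCommGroup Y] [NormedSpace ℝ Y] {ε : ℝ} (hε : 0 < ε) {f : X → Y}
    (hf : StdEpsIsom ε f) (r : ℝ) (p : X →L[ℝ] ℝ) (hp : ‖p‖ ≤ r) :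
    ∃ φ : Y →ₗ[ℝ] ℝ, (∀ y, |φ y| ≤ r * ‖y‖) ∧ ∀ x, |φ (f x) - p x| ≤ 3 * r * ε := by
  have hr : 0 ≤ r := (norm_nonneg _).trans hp
  let M : (X →₀ ℝ) →ₗ[ℝ] Y × (X →₀ ℝ) :=
    (Finsupp.linearCombination ℝ f).prod LinearMap.id
  let q : Y × (X →₀ ℝ) →ₗ[ℝ] ℝ :=
    (p : X →ₗ[ℝ] ℝ) ∘ₗ Finsupp.linearCombination ℝ (id : X → X) ∘ₗ LinearMap.snd ℝ Y (X →₀ ℝ)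
  let n1 : (X →₀ ℝ) → ℝ := fun a => a.sum fun _ c => |c|
  have n1_add : ∀ a b, n1 (a + b) ≤ n1 a + n1 b := by
    classical
    intro a b
    have h : ∀ c : X →₀ ℝ, c.support ⊆ a.support ∪ b.support →
        n1 c = ∑ x ∈ a.support ∪ b.support, |c x| := fun c hc =>
      Finsupp.sum_of_support_subset _ hc _ (by simp)
    rw [h a Finset.subset_union_left, h b Finset.subset_union_right,
      h (a + b) Finsupp.support_add, ← Finset.sum_add_distrib]
    exact Finset.sum_le_sum fun x _ => abs_add_le _ _
  have n1_smul : ∀ c : ℝ, 0 < c → ∀ a, n1 (c • a) = c * n1 a := by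
    intro c hc a
    simp only [n1]
    rw [Finsupp.sum_smul_index (by simp), Finsupp.mul_sum]
    simp [abs_mul, abs_of_pos hc]
  obtain ⟨ψ, hψ, hψN⟩ := exists_extension_of_le_sublinear
    (⟨LinearMap.range M, q.domRestrict (LinearMap.range M)⟩ : Y × (X →₀ ℝ) →ₗ.[ℝ] ℝ)
    (fun z => r * (‖z.1‖ + 3 * ε * n1 z.2))
    (by
      intro c hc z
      simp only [Prod.smul_fst, Prod.smul_snd, n1_smul c hc, norm_smul,
        Real.norm_of_nonneg hc.le]
      ring)
    (by
      intro z w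
      rw [← mul_add]
      refine mul_le_mul_of_nonneg_left ?_ hr
      have h1 := norm_add_le z.1 w.1
      have h2 := mul_le_mul_of_nonneg_left (n1_add z.2 w.2) (by positivity : 0 ≤ 3 * ε)
      simp only [Prod.fst_add, Prod.snd_add]
      linarith)
    (by
      rintro ⟨_, a, rfl⟩
      have h := key_ineq hf a.support a
      change p (Finsupp.linearCombination ℝ (id : X → X) a) ≤
        r * (‖Finsupp.linearCombination ℝ f a‖ + 3 * ε * n1 a)
      refine ((le_abs_self _).trans (p.le_of_opNorm_le hp _)).trans ?_
      exact mul_le_mul_of_nonneg_left h hr)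
  have hψ1 : ∀ y, ψ (y, 0) ≤ r * ‖y‖ := by
    intro y
    simpa [n1] using hψN (y, 0)
  refine ⟨ψ ∘ₗ LinearMap.inl ℝ Y (X →₀ ℝ), fun y => ?_, fun x => ?_⟩
  · rw [abs_le']
    refine ⟨hψ1 y, ?_⟩
    have := hψ1 (-y)
    rw [norm_neg] at this
    rw [← map_neg]
    exact this
  · have h1 : ψ (f x, Finsupp.single x 1) = p x := by
      have := hψ ⟨M (Finsupp.single x 1), ⟨_, rfl⟩⟩
      simpa [M, q, LinearMap.domRestrict_apply] using this
    have h2 : ψ (f x, Finsupp.single x 1) = ψ (f x, 0) + ψ (0, Finsupp.single x 1) := by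
      rw [← map_add]; simp
    have h3 : ψ (0, Finsupp.single x 1) ≤ 3 * r * ε := by
      have := hψN (0, Finsupp.single x 1)
      simp [n1] at this
      linarith
    have h4 : - ψ (0, Finsupp.single x 1) ≤ 3 * r * ε := by
      have := hψN (0, Finsupp.single x (-1))
      have e : ((0 : Y), Finsupp.single x (-1 : ℝ)) = -(0, Finsupp.single x 1) := by
        simp
      have e' : n1 (Finsupp.single x (-1 : ℝ)) = 1 := by
        simp only [n1]
        rw [Finsupp.sum_single_index (by simp)]
        simp
      simp only [e', norm_zero] at this
      rw [e, map_neg] at this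
      linarith
    change |ψ (f x, 0) - p x| ≤ _
    rw [abs_le]
    constructor <;> linarith

/-- If `X` is isomorphic to `ℓ∞` via `T` and `λ = ‖T‖ ‖T⁻¹‖`, then `X` is universally
`(λ, 4λ)`-left-stable. -/
theorem stmt8 {X : Type} [NormedAddCommGroup X] [NormedSpace ℝ X] [CompleteSpace X]
    (T : X ≃L[ℝ] ellInfty) (lam : ℝ)
    (hlam : lam = ‖(T : X →L[ℝ] ellInfty)‖ * ‖(T.symm : ellInfty →L[ℝ] X)‖) :
    ∀ (Y : Type v) [NormedAddCommGroup Y] [NormedSpace ℝ Y] [CompleteSpace Y],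
      ∀ ε : ℝ, 0 < ε → ∀ f : X → Y, StdEpsIsom ε f →
        ∃ S : Lf f →L[ℝ] X, ‖S‖ ≤ lam ∧
          ∀ x : X, ‖S ⟨f x, mem_Lf f x⟩ - x‖ ≤ 4 * lam * ε := by
  intro Y _ _ _ ε hε f hf
  set r := ‖(T : X →L[ℝ] ellInfty)‖ with hr
  have hr0 : 0 ≤ r := norm_nonneg _
  have hcoord : ∀ (n : ℕ) (x : X), |(T x : ellInfty) n| ≤ r * ‖x‖ := fun n x =>
    (lp.norm_apply_le_norm (by simp) (T x) n).trans ((T : X →L[ℝ] ellInfty).le_opNorm x)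
  let p : ℕ → X →L[ℝ] ℝ := fun n =>
    LinearMap.mkContinuous
      { toFun := fun x => (T x : ellInfty) n
        map_add' := fun x y => by simp
        map_smul' := fun c x => by simp } r (hcoord n)
  have hp : ∀ n, ‖p n‖ ≤ r := fun n => LinearMap.mkContinuous_norm_le _ hr0 _
  choose φ hφ hφf using fun n => weak_stab hε hf r (p n) (hp n)
  have hmem : ∀ y : Y, Memℓp (fun n => φ n y) ∞ := fun y =>
    memℓp_infty ⟨r * ‖y‖, by rintro _ ⟨n, rfl⟩; exact hφ n y⟩
  let Φ : Y →L[ℝ] ellInfty :=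
    LinearMap.mkContinuous
      { toFun := fun y => (⟨fun n => φ n y, hmem y⟩ : ellInfty)
        map_add' := fun x y => by ext n; exact map_add (φ n) x y
        map_smul' := fun c x => by ext n; exact map_smul (φ n) c x } r
      (fun y => lp.norm_le_of_forall_le (by positivity) (fun n => hφ n y))
  have hΦ : ‖Φ‖ ≤ r := LinearMap.mkContinuous_norm_le _ hr0 _
  refine ⟨((T.symm : ellInfty →L[ℝ] X) ∘L Φ) ∘L (Lf f).subtypeL, ?_, fun x => ?_⟩
  · rw [hlam]
    refine ContinuousLinearMap.opNorm_le_bound _ (by positivity) fun y => ?_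
    have h1 := (T.symm : ellInfty →L[ℝ] X).le_opNorm (Φ y)
    have h2 := Φ.le_of_opNorm_le hΦ (y : Y)
    refine h1.trans ?_
    rw [mul_comm r, mul_assoc]
    exact mul_le_mul_of_nonneg_left h2 (norm_nonneg _)
  · have h1 : ‖Φ (f x) - T x‖ ≤ 3 * r * ε :=
      lp.norm_le_of_forall_le (by positivity) (fun n => hφf n x)
    have h2 := (T.symm : ellInfty →L[ℝ] X).le_opNorm (Φ (f x) - T x)
    have h3 : (T.symm : ellInfty →L[ℝ] X) (Φ (f x) - T x) = T.symm (Φ (f x)) - x := by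
      simp
    rw [h3] at h2
    have h4 := mul_le_mul_of_nonneg_left h1 (norm_nonneg (T.symm : ellInfty →L[ℝ] X))
    have h5 : 0 ≤ r * ‖(T.symm : ellInfty →L[ℝ] X)‖ * ε := by positivity
    change ‖T.symm (Φ (f x)) - x‖ ≤ _
    rw [hlam]
    nlinarith
end
end

section
/- Let X be a real Banach space and let T : X → c₀ be a bounded linear bijection onto c₀ with bounded inverse, and set α = ‖T‖·‖T⁻¹‖. Then for every separable real Banach space Y the pair (X, Y) is (2α, 8α)-stable: for every ε > 0 and every standard ε-isometry f : X → Y there exists a bounded linear operator S : L(f) → X with ‖S‖ ≤ 2α such that ‖S(f(x)) − x‖ ≤ 8αε for all x ∈ X. -/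
open scoped ENNReal ZeroAtInfty

noncomputable section

open Filter Topology
open scoped Pointwise

/-- Weak-star compactness in the form of finitely many constraints. -/
lemma dual_compactness {Y ι : Type*} [NormedAddCommGroup Y] [NormedSpace ℝ Y]
    (r c : ℝ) (g : ι → Y) (a : ι → ℝ)
    (h : ∀ s : Finset ι, ∃ φ : StrongDual ℝ Y, ‖φ‖ ≤ r ∧ ∀ i ∈ s, |φ (g i) - a i| ≤ c) :
    ∃ φ : StrongDual ℝ Y, ‖φ‖ ≤ r ∧ ∀ i, |φ (g i) - a i| ≤ c := by
  have hK := WeakDual.isCompact_closedBall (𝕜 := ℝ) (E := Y) 0 r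
  obtain ⟨φ, hφ, hφ'⟩ := hK.inter_iInter_nonempty
    (fun i => {φ : WeakDual ℝ Y | |φ (g i) - a i| ≤ c})
    (fun i => isClosed_le (by
      exact ((WeakDual.eval_continuous (𝕜 := ℝ) (g i)).sub continuous_const).abs)
        continuous_const)
    (fun s => by
      obtain ⟨φ, h1, h2⟩ := h s
      refine ⟨StrongDual.toWeakDual φ, ?_, ?_⟩
      · simpa using h1
      · simp only [Set.mem_iInter]
        exact fun i hi => h2 i hi)
  refine ⟨WeakDual.toStrongDual φ, by simpa using hφ, fun i => ?_⟩
  exact Set.mem_iInter.1 hφ' i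

/-- Smooth points. -/
lemma smooth_point {F Y : Type*} [NormedAddCommGroup F] [NormedSpace ℝ F]
    [NormedAddCommGroup Y] [NormedSpace ℝ Y] {ε : ℝ} {f : F → Y} (hf : StdEpsIsom ε f)
    {x₀ : F} {d : StrongDual ℝ F} (hd : HasFDerivAt (fun x : F => ‖x‖) d x₀) :
    ∃ φ : StrongDual ℝ Y, ‖φ‖ ≤ 1 ∧ ∀ x, |φ (f x) - d x| ≤ 4 * ε := by
  obtain ⟨f0, hf⟩ := hf
  have key : ∀ φ : StrongDual ℝ Y, ‖φ‖ ≤ 1 → ∀ x y, φ (f x) - φ (f y) ≤ ‖x - y‖ + ε := by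
    intro φ hφ x y
    have h1 := φ.le_of_opNorm_le hφ (f x - f y)
    have h2 := (abs_le.1 (hf x y)).2
    rw [map_sub, Real.norm_eq_abs] at h1
    have := (abs_le.1 h1).2
    linarith
  obtain ⟨φ, hφ, h⟩ := dual_compactness 1 (3 * ε) (fun t : ℝ => f (t • x₀))
      (fun t => t * ‖x₀‖) (by
    intro s
    obtain ⟨M, hM⟩ := (s.image (fun t => |t|)).exists_le
    obtain ⟨n, hn0, hn⟩ : ∃ n : ℝ, 0 ≤ n ∧ ∀ t ∈ s, |t| ≤ n :=
      ⟨max M 0, le_max_right _ _, fun t ht =>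
        (hM _ (Finset.mem_image_of_mem _ ht)).trans (le_max_left _ _)⟩
    obtain ⟨φ, hφ, hφn⟩ := exists_dual_vector'' ℝ (f (n • x₀) - f ((-n) • x₀))
    refine ⟨φ, hφ, fun t ht => ?_⟩
    have ht' := abs_le.1 (hn t ht)
    have nrm : ∀ a b : ℝ, b ≤ a → ‖a • x₀ - b • x₀‖ = (a - b) * ‖x₀‖ := by
      intro a b hab
      rw [← sub_smul, norm_smul, Real.norm_eq_abs, abs_of_nonneg (by linarith)]
    have h0 := (abs_le.1 (hf (n • x₀) ((-n) • x₀))).1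
    have e1 := key φ hφ (n • x₀) (t • x₀)
    have e2 := key φ hφ (t • x₀) ((-n) • x₀)
    have e3 := key φ hφ (n • x₀) ((0:ℝ) • x₀)
    have e4 := key φ hφ ((0:ℝ) • x₀) ((-n) • x₀)
    rw [nrm _ _ (by linarith)] at h0 e1 e2 e3 e4
    rw [zero_smul, f0, map_zero] at e3 e4
    simp only [map_sub, RCLike.ofReal_real_eq_id, id] at hφn
    rw [abs_le]
    constructor <;> linarith)
  refine ⟨φ, hφ, fun x => ?_⟩
  have L1 := hd.lim_real x
  have L2 := hd.lim_real (-x)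
  have tr : ∀ c : ℝ, 0 < c → ∀ v : F,
      c • (‖x₀ + c⁻¹ • v‖ - ‖x₀‖) = ‖c • x₀ + v‖ - c * ‖x₀‖ := by
    intro c hc v
    have : c • x₀ + v = c • (x₀ + c⁻¹ • v) := by
      rw [smul_add, smul_smul, mul_inv_cancel₀ hc.ne', one_smul]
    rw [this, norm_smul, Real.norm_eq_abs, abs_of_pos hc, smul_eq_mul]; ring
  have u1 : φ (f x) - 4 * ε ≤ d x := by
    refine ge_of_tendsto L1 ?_
    filter_upwards [eventually_gt_atTop 0] with c hc
    rw [tr c hc]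
    have a1 := (abs_le.1 (h (-c))).2
    have a2 := key φ hφ x ((-c) • x₀)
    have : x - (-c) • x₀ = c • x₀ + x := by rw [neg_smul]; abel
    rw [this] at a2
    linarith
  have u2 : -φ (f x) - 4 * ε ≤ d (-x) := by
    refine ge_of_tendsto L2 ?_
    filter_upwards [eventually_gt_atTop 0] with c hc
    rw [tr c hc]
    have a1 := (abs_le.1 (h c)).1
    have a2 := key φ hφ (c • x₀) x
    rw [sub_eq_add_neg (c • x₀) x] at a2
    linarith
  rw [map_neg] at u2
  rw [abs_le]
  constructor <;> linarith

/-- Weak stability, finitely many points. -/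
lemma weak_stability_finite {X Y : Type*} [NormedAddCommGroup X] [NormedSpace ℝ X]
    [NormedAddCommGroup Y] [NormedSpace ℝ Y] {ε : ℝ} {f : X → Y} (hf : StdEpsIsom ε f)
    (u : StrongDual ℝ X) (hu : ‖u‖ ≤ 1) (s : Finset X) :
    ∃ φ : StrongDual ℝ Y, ‖φ‖ ≤ 1 ∧ ∀ x ∈ s, |φ (f x) - u x| ≤ 4 * ε := by
  classical
  have hε : 0 ≤ ε := (abs_nonneg _).trans (hf.2 0 0)
  let F : Submodule ℝ X := Submodule.span ℝ (s : Set X)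
  have : FiniteDimensional ℝ F := FiniteDimensional.span_finset ℝ s
  let ev : WeakDual ℝ Y → (s → ℝ) := fun φ i => φ (f i)
  have hev : Continuous ev := continuous_pi fun i => WeakDual.eval_continuous (f i)
  let B : Set (WeakDual ℝ Y) := WeakDual.toStrongDual ⁻¹' Metric.closedBall 0 1
  have hB : IsCompact B := WeakDual.isCompact_closedBall 0 1
  let C : Set (s → ℝ) := {p | ∃ φ : StrongDual ℝ Y, ‖φ‖ ≤ 1 ∧ ∀ i : s, |φ (f i) - p i| ≤ 4 * ε}
  have hC : C = ev '' B + Metric.closedBall (0 : s → ℝ) (4 * ε) := by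
    ext p
    rw [Set.mem_add]
    constructor
    · rintro ⟨φ, h1, h2⟩
      refine ⟨ev (StrongDual.toWeakDual φ), ⟨_, by simpa [B] using h1, rfl⟩,
        p - ev (StrongDual.toWeakDual φ), ?_, by abel⟩
      rw [mem_closedBall_zero_iff, pi_norm_le_iff_of_nonneg (by positivity)]
      intro i
      rw [Real.norm_eq_abs, Pi.sub_apply, abs_sub_comm]
      exact h2 i
    · rintro ⟨_, ⟨φ, hφ, rfl⟩, q, hq, rfl⟩
      refine ⟨WeakDual.toStrongDual φ, by simpa [B] using hφ, fun i => ?_⟩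
      rw [mem_closedBall_zero_iff, pi_norm_le_iff_of_nonneg (by positivity)] at hq
      have := hq i
      rw [Real.norm_eq_abs] at this
      rw [Pi.add_apply, abs_sub_comm]
      change |φ (f i) + q i - φ (f i)| ≤ _
      rwa [add_sub_cancel_left]
  have hCc : IsClosed C := by
    rw [hC]
    exact ((hB.image hev).add (isCompact_closedBall _ _)).isClosed
  have hCconv : Convex ℝ C := by
    rintro p ⟨φ, h1, h2⟩ q ⟨ψ, h3, h4⟩ a b ha hb hab
    refine ⟨a • φ + b • ψ, ?_, fun i => ?_⟩
    · calc ‖a • φ + b • ψ‖ ≤ ‖a • φ‖ + ‖b • ψ‖ := norm_add_le _ _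
        _ = a * ‖φ‖ + b * ‖ψ‖ := by
          rw [norm_smul, norm_smul, Real.norm_eq_abs, Real.norm_eq_abs, abs_of_nonneg ha,
            abs_of_nonneg hb]
        _ ≤ 1 := by nlinarith
    · have e2 := abs_le.1 (h2 i)
      have e4 := abs_le.1 (h4 i)
      simp only [_root_.add_apply, _root_.smul_apply, Pi.add_apply,
        Pi.smul_apply, smul_eq_mul]
      rw [abs_le]
      constructor <;> nlinarith
  by_cases hmem : (fun i : s => u i) ∈ C
  · obtain ⟨φ, h1, h2⟩ := hmem
    exact ⟨φ, h1, fun x hx => h2 ⟨x, hx⟩⟩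
  exfalso
  obtain ⟨g, w, hw1, hw2⟩ := geometric_hahn_banach_closed_point hCconv hCc hmem
  have mems : ∀ i : s, (i : X) ∈ F := fun i => Submodule.subset_span i.2
  have hg : ∀ p : s → ℝ, g p = ∑ i, p i * g (Pi.single i 1) := by
    intro p
    conv_lhs => rw [pi_eq_sum_univ' p]
    rw [map_sum]
    refine Finset.sum_congr rfl fun i _ => ?_
    rw [map_smul, smul_eq_mul]
  let z : F := ∑ i : s, g (Pi.single i 1) • (⟨i, mems i⟩ : F)
  have hgz : ∀ v : StrongDual ℝ F, g (fun i => v ⟨i, mems i⟩) = v z := by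
    intro v
    rw [hg, map_sum]
    refine Finset.sum_congr rfl fun i _ => ?_
    rw [map_smul, smul_eq_mul, mul_comm]
  have huz : w < ‖z‖ := by
    have := hgz (u.comp F.subtypeL)
    have h2 : g (fun i : s => u i) = u z := this
    rw [h2] at hw2
    have h3 := u.le_of_opNorm_le hu (z : X)
    rw [Real.norm_eq_abs, one_mul] at h3
    exact hw2.trans_le ((le_abs_self _).trans h3)
  have hdense := dense_differentiableAt_norm (E := F)
  obtain ⟨x₀, hx₀, hd⟩ := Metric.dense_iff.1 hdense z ((‖z‖ - w) / 2) (by linarith)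
  rw [Metric.mem_ball, dist_eq_norm] at hx₀
  have hd : DifferentiableAt ℝ (fun x : F => ‖x‖) x₀ := hd
  have hfF : StdEpsIsom ε (fun x : F => f x) := ⟨hf.1, fun x y => hf.2 x y⟩
  obtain ⟨φ, hφ, hφd⟩ := smooth_point hfF hd.hasFDerivAt
  have hin := hw1 _ (show (fun i : s => fderiv ℝ (fun x : F => ‖x‖) x₀ ⟨i, mems i⟩) ∈ C from
    ⟨φ, hφ, fun i => hφd ⟨i, mems i⟩⟩)
  rw [hgz] at hin
  have e1 : fderiv ℝ (fun x : F => ‖x‖) x₀ x₀ = ‖x₀‖ := hd.fderiv_norm_self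
  have e2 : ‖fderiv ℝ (fun x : F => ‖x‖) x₀‖ ≤ 1 := by
    exact (norm_fderiv_le_of_lipschitz ℝ (lipschitzWith_one_norm (E := F)) (x₀ := x₀)).trans
      (by simp)
  have e3 := (fderiv ℝ (fun x : F => ‖x‖) x₀).le_of_opNorm_le e2 (x₀ - z)
  rw [map_sub, e1, Real.norm_eq_abs] at e3
  have e4 := (abs_le.1 e3).2
  have e5 := norm_sub_norm_le z x₀
  rw [norm_sub_rev] at e5
  linarith

/-- Weak stability. -/
lemma weak_stability {X Y : Type*} [NormedAddCommGroup X] [NormedSpace ℝ X]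
    [NormedAddCommGroup Y] [NormedSpace ℝ Y] {ε : ℝ} {f : X → Y} (hf : StdEpsIsom ε f)
    (u : StrongDual ℝ X) (r : ℝ) (hr : 0 ≤ r) (hu : ‖u‖ ≤ r) :
    ∃ φ : StrongDual ℝ Y, ‖φ‖ ≤ r ∧ ∀ x, |φ (f x) - u x| ≤ 4 * ε * r := by
  rcases hr.eq_or_lt with rfl | hr
  · have : u = 0 := norm_le_zero_iff.1 hu
    exact ⟨0, by simp, fun x => by simp [this]⟩
  have h1 : ‖r⁻¹ • u‖ ≤ 1 := by
    rw [norm_smul, norm_inv, Real.norm_eq_abs, abs_of_pos hr, inv_mul_le_iff₀ hr]; linarith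
  obtain ⟨φ, hφ, h⟩ := dual_compactness 1 (4 * ε) f (fun x => (r⁻¹ • u) x)
    (fun s => weak_stability_finite hf _ h1 s)
  refine ⟨r • φ, ?_, fun x => ?_⟩
  · rw [norm_smul, Real.norm_eq_abs, abs_of_pos hr]; nlinarith
  · have h2 := h x
    have : (r • φ) (f x) - u x = r * (φ (f x) - (r⁻¹ • u) x) := by
      simp only [_root_.smul_apply, smul_eq_mul]
      field_simp
    rw [this, abs_mul, abs_of_pos hr]
    nlinarith

/-- The Veech-type argument: correct a sequence of functionals to be weak-star null. -/
lemma veech {X Y : Type*} [NormedAddCommGroup Y] [NormedSpace ℝ Y]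
    [TopologicalSpace.SeparableSpace Y] (f : X → Y) (r c : ℝ) (hr : 0 ≤ r) (hc : 0 ≤ c)
    (φ : ℕ → StrongDual ℝ Y) (hφ : ∀ n, ‖φ n‖ ≤ r) (a : ℕ → X → ℝ)
    (ha : ∀ x, Tendsto (fun n => a n x) atTop (𝓝 0))
    (hφa : ∀ n x, |φ n (f x) - a n x| ≤ c) :
    ∃ ψ : ℕ → StrongDual ℝ Y, (∀ n, ‖ψ n‖ ≤ r) ∧ (∀ n x, |ψ n (f x)| ≤ c) ∧
      ∀ y, Tendsto (fun n => φ n y - ψ n y) atTop (𝓝 0) := by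
  let B : Set (WeakDual ℝ Y) := WeakDual.toStrongDual ⁻¹' Metric.closedBall 0 r
  have hB : IsCompact B := WeakDual.isCompact_closedBall 0 r
  have hmB : ∀ p : WeakDual ℝ Y, p ∈ B ↔ ‖WeakDual.toStrongDual p‖ ≤ r := by
    intro p; simp [B]
  have : TopologicalSpace.MetrizableSpace B := WeakDual.metrizable_of_isCompact ℝ Y B hB
  let _ : MetricSpace B := TopologicalSpace.metrizableSpaceMetric B
  have : CompactSpace B := isCompact_iff_compactSpace.1 hB
  have evc : ∀ y : Y, Continuous fun p : B => p.1 y := fun y =>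
    (WeakDual.eval_continuous (𝕜 := ℝ) y).comp continuous_subtype_val
  let K : Set B := {p | ∀ x, |p.1 (f x)| ≤ c}
  have hK : IsClosed K := by
    have : K = ⋂ x, {p : B | |p.1 (f x)| ≤ c} := by ext p; simp [K]
    rw [this]
    exact isClosed_iInter fun x => isClosed_le (evc (f x)).abs continuous_const
  have hK0 : K.Nonempty := by
    refine ⟨⟨0, (hmB _).2 (by simpa using hr)⟩, fun x => ?_⟩
    change |(0:ℝ)| ≤ c
    simpa using hc
  let Φ : ℕ → B := fun n => ⟨StrongDual.toWeakDual (φ n), (hmB _).2 (hφ n)⟩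
  have hd : Tendsto (fun n => Metric.infDist (Φ n) K) atTop (𝓝 0) := by
    rw [tendsto_iff_ultrafilter]
    intro U hU
    obtain ⟨p, -, hp⟩ := isCompact_univ.ultrafilter_le_nhds (U.map Φ) (by simp)
    have hp : Tendsto Φ U (𝓝 p) := hp
    have hpK : p ∈ K := by
      intro x
      have t1 : Tendsto (fun n => (Φ n).1 (f x)) U (𝓝 (p.1 (f x))) :=
        ((evc (f x)).tendsto p).comp hp
      have t2 := (t1.sub ((ha x).mono_left hU)).abs
      rw [sub_zero] at t2
      exact le_of_tendsto t2 (Eventually.of_forall fun n => hφa n x)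
    have := ((Metric.continuous_infDist_pt K).tendsto p).comp hp
    rw [Metric.infDist_zero_of_mem hpK] at this
    exact this
  have hex : ∀ n, ∃ q ∈ K, Metric.infDist (Φ n) K = dist (Φ n) q := fun n =>
    hK.isCompact.exists_infDist_eq_dist hK0 (Φ n)
  choose Ψ hΨ hΨd using hex
  refine ⟨fun n => WeakDual.toStrongDual (Ψ n).1, fun n => (hmB _).1 (Ψ n).2,
    fun n x => hΨ n x, fun y => ?_⟩
  have huc := CompactSpace.uniformContinuous_of_continuous (evc y)
  rw [Metric.uniformContinuous_iff] at huc
  rw [Metric.tendsto_atTop]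
  intro e he
  obtain ⟨δ, hδ, hh⟩ := huc e he
  obtain ⟨N, hN⟩ := Metric.tendsto_atTop.1 hd δ hδ
  refine ⟨N, fun n hn => ?_⟩
  have h1 := hN n hn
  rw [hΨd, Real.dist_0_eq_abs, abs_of_nonneg dist_nonneg] at h1
  have h2 := hh h1
  rw [Real.dist_eq] at h2
  rw [Real.dist_0_eq_abs]
  exact h2

lemma c0_norm_le {r : ℝ} (hr : 0 ≤ r) (g : C₀(ℕ, ℝ)) : ‖g‖ ≤ r ↔ ∀ n, |g n| ≤ r := by
  rw [← ZeroAtInftyContinuousMap.norm_toBCF_eq_norm, BoundedContinuousFunction.norm_le hr]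
  rfl

universe v

/-- If `X` is isomorphic to `c₀` via `T` and `α = ‖T‖ ‖T⁻¹‖`, then `(X, Y)` is
`(2α, 8α)`-stable for every separable Banach space `Y`. -/
theorem stmt10 {X : Type} [NormedAddCommGroup X] [NormedSpace ℝ X] [CompleteSpace X]
    (T : X ≃L[ℝ] C₀(ℕ, ℝ)) (α : ℝ)
    (hα : α = ‖(T : X →L[ℝ] C₀(ℕ, ℝ))‖ * ‖(T.symm : C₀(ℕ, ℝ) →L[ℝ] X)‖) :
    ∀ (Y : Type v) [NormedAddCommGroup Y] [NormedSpace ℝ Y] [CompleteSpace Y]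
      [TopologicalSpace.SeparableSpace Y],
      ∀ ε : ℝ, 0 < ε → ∀ f : X → Y, StdEpsIsom ε f →
        ∃ S : Lf f →L[ℝ] X, ‖S‖ ≤ 2 * α ∧
          ∀ x : X, ‖S ⟨f x, mem_Lf f x⟩ - x‖ ≤ 8 * α * ε := by
  intro Y _ _ _ _ ε hε f hf
  set r : ℝ := ‖(T : X →L[ℝ] C₀(ℕ, ℝ))‖ with hrdef
  have hr : 0 ≤ r := norm_nonneg (T : X →L[ℝ] C₀(ℕ, ℝ))
  have hTr : ∀ x n, |T x n| ≤ r * ‖x‖ := fun x n =>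
    (c0_norm_le (by positivity) (T x)).1 ((T : X →L[ℝ] C₀(ℕ, ℝ)).le_opNorm x) n
  let u : ℕ → StrongDual ℝ X := fun n => LinearMap.mkContinuous
    { toFun := fun x => T x n
      map_add' := fun x y => by simp
      map_smul' := fun c x => by simp } r (fun x => hTr x n)
  have hu : ∀ n, ‖u n‖ ≤ r := fun n => LinearMap.mkContinuous_norm_le _ hr _
  choose φ hφ hφu using fun n => weak_stability hf (u n) r hr (hu n)
  have hc : 0 ≤ 4 * ε * r := by positivity
  obtain ⟨ψ, hψ, hψf, hlim⟩ := veech f r (4 * ε * r) hr hc φ hφ (fun n x => T x n)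
    (fun x => by
      have := (T x).zero_at_infty'
      rw [Filter.cocompact_eq_cofinite, Nat.cofinite_eq_atTop] at this
      exact this) hφu
  let S₀ : Y →L[ℝ] C₀(ℕ, ℝ) := LinearMap.mkContinuous
    { toFun := fun y => ⟨⟨fun n => φ n y - ψ n y, continuous_of_discreteTopology⟩, by
        rw [Filter.cocompact_eq_cofinite, Nat.cofinite_eq_atTop]; exact hlim y⟩
      map_add' := fun y z => by
        ext n
        change φ n (y + z) - ψ n (y + z) = (φ n y - ψ n y) + (φ n z - ψ n z)
        rw [map_add, map_add]; ring
      map_smul' := fun c y => by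
        ext n
        change φ n (c • y) - ψ n (c • y) = c * (φ n y - ψ n y)
        rw [map_smul, map_smul, smul_eq_mul, smul_eq_mul]; ring } (2 * r) (fun y => by
      rw [c0_norm_le (by positivity)]
      intro n
      change |φ n y - ψ n y| ≤ _
      have h1 := (φ n).le_of_opNorm_le (hφ n) y
      have h2 := (ψ n).le_of_opNorm_le (hψ n) y
      rw [Real.norm_eq_abs] at h1 h2
      have h3 := abs_sub (φ n y) (ψ n y)
      linarith)
  have hS₀ : ‖S₀‖ ≤ 2 * r := LinearMap.mkContinuous_norm_le _ (by positivity) _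
  have hb : 0 ≤ ‖(T.symm : C₀(ℕ, ℝ) →L[ℝ] X)‖ :=
    norm_nonneg (T.symm : C₀(ℕ, ℝ) →L[ℝ] X)
  refine ⟨(T.symm : C₀(ℕ, ℝ) →L[ℝ] X).comp (S₀.comp (Lf f).subtypeL), ?_, fun x => ?_⟩
  · refine ContinuousLinearMap.opNorm_le_bound _ (by rw [hα]; positivity) fun y => ?_
    have h1 := (T.symm : C₀(ℕ, ℝ) →L[ℝ] X).le_opNorm (S₀ y)
    have h2 := S₀.le_of_opNorm_le hS₀ (y : Y)
    calc _ ≤ ‖(T.symm : C₀(ℕ, ℝ) →L[ℝ] X)‖ * ‖S₀ y‖ := h1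
      _ ≤ ‖(T.symm : C₀(ℕ, ℝ) →L[ℝ] X)‖ * (2 * r * ‖(y : Y)‖) := by gcongr
      _ = 2 * α * ‖y‖ := by rw [hα, Submodule.coe_norm]; ring
  · have e : (T.symm : C₀(ℕ, ℝ) →L[ℝ] X) (S₀ (f x) - T x)
        = (T.symm : C₀(ℕ, ℝ) →L[ℝ] X) (S₀ (f x)) - x := by
      rw [map_sub]; simp
    change ‖(T.symm : C₀(ℕ, ℝ) →L[ℝ] X) (S₀ (f x)) - x‖ ≤ _
    rw [← e]
    have h2 : ‖S₀ (f x) - T x‖ ≤ 8 * ε * r := by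
      rw [c0_norm_le (by positivity)]
      intro n
      change |φ n (f x) - ψ n (f x) - T x n| ≤ _
      have h1 : |φ n (f x) - T x n| ≤ 4 * ε * r := hφu n x
      have h3 := hψf n x
      rw [abs_le] at *
      constructor <;> linarith
    calc _ ≤ ‖(T.symm : C₀(ℕ, ℝ) →L[ℝ] X)‖ * ‖S₀ (f x) - T x‖ :=
          (T.symm : C₀(ℕ, ℝ) →L[ℝ] X).le_opNorm _
      _ ≤ ‖(T.symm : C₀(ℕ, ℝ) →L[ℝ] X)‖ * (8 * ε * r) := by gcongr
      _ = 8 * α * ε := by rw [hα]; ring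
end
end
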